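/- (Uniform L² bound for inhomogeneous Klein–Gordon equations.) Let m ∈ [0,1], q ∈ ℝ, and C₀, C_f ≥ 0. Let u₀, u₁ be Schwartz functions on ℝ³, let f be smooth on [2,∞) × ℝ³ with f(t,·) Schwartz for each t, and let u be a smooth solution on [2,∞) × ℝ³ of −□u + m²u = f with (u, ∂_t u)(2, ·) = (u₀, u₁), such that u(t,·) and ∂_t u(t,·) are Schwartz for each t, depending smoothly on t. Assume ‖u₀‖_{L²(ℝ³)} + ‖ |x| u₁ ‖_{L²(ℝ³)} ≤ C₀ and ‖ |x| f(t,·) ‖_{L²(ℝ³)} ≤ C_f t^{−1+q} for all t ≥ 2. Then there is a constant C > 0, depending only on q (in particular independent of m), such that for all t ≥ 2: ‖u(t,·)‖_{L²(ℝ³)} ≤ C(C₀ + C_f t^q) if q > 0; ‖u(t,·)‖_{L²(ℝ³)} ≤ C(C₀ + C_f (1 + log t)) if q = 0; and ‖u(t,·)‖_{L²(ℝ³)} ≤ C(C₀ + C_f) if q < 0. -/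

import Mathlib

open MeasureTheory Real
noncomputable section

def pder (α : Fin 4) (φ : (Fin 4 → ℝ) → ℝ) (y : Fin 4 → ℝ) : ℝ :=
  fderiv ℝ φ y (Pi.single α 1)

def Lb (a : Fin 3) (φ : (Fin 4 → ℝ) → ℝ) (y : Fin 4 → ℝ) : ℝ :=
  y a.succ * pder 0 φ y + y 0 * pder a.succ φ y

def rotVF (a b : Fin 3) (φ : (Fin 4 → ℝ) → ℝ) (y : Fin 4 → ℝ) : ℝ :=
  y a.succ * pder b.succ φ y - y b.succ * pder a.succ φ y

def Box (φ : (Fin 4 → ℝ) → ℝ) (y : Fin 4 → ℝ) : ℝ :=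
  - pder 0 (pder 0 φ) y + ∑ a : Fin 3, pder a.succ (pder a.succ φ) y

inductive VF : Type
  | pd : Fin 4 → VF
  | boost : Fin 3 → VF
  | rot : Fin 3 → Fin 3 → VF
  deriving DecidableEq, Fintype

def VF.apply : VF → ((Fin 4 → ℝ) → ℝ) → ((Fin 4 → ℝ) → ℝ)
  | .pd α, φ => pder α φ
  | .boost a, φ => Lb a φ
  | .rot a b, φ => rotVF a b φ

def applyComp {n : ℕ} (Γ : Fin n → VF) (φ : (Fin 4 → ℝ) → ℝ) : (Fin 4 → ℝ) → ℝ :=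
  (List.ofFn Γ).foldr VF.apply φ

def spt (t : ℝ) (x : Fin 3 → ℝ) : Fin 4 → ℝ := Fin.cons t x
def rad (x : Fin 3 → ℝ) : ℝ := Real.sqrt (∑ i, x i ^ 2)
def L2normSq (g : (Fin 3 → ℝ) → ℝ) : ℝ := ∫ x : Fin 3 → ℝ, g x ^ 2
def L2norm (g : (Fin 3 → ℝ) → ℝ) : ℝ := Real.sqrt (L2normSq g)

def pderx (a : Fin 3) (g : (Fin 3 → ℝ) → ℝ) (x : Fin 3 → ℝ) : ℝ :=
  fderiv ℝ g x (Pi.single a 1)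
def pderxIter (k : Fin 3 → ℕ) (g : (Fin 3 → ℝ) → ℝ) : (Fin 3 → ℝ) → ℝ :=
  (pderx 0)^[k 0] ((pderx 1)^[k 1] ((pderx 2)^[k 2] g))
def sobNormSq (N : ℕ) (g : (Fin 3 → ℝ) → ℝ) : ℝ :=
  ∑ k ∈ Finset.univ.filter (fun k : Fin 3 → Fin (N+1) => ∑ i, (k i : ℕ) ≤ N),
    L2normSq (pderxIter (fun i => (k i : ℕ)) g)
def sobNorm (N : ℕ) (g : (Fin 3 → ℝ) → ℝ) : ℝ := Real.sqrt (sobNormSq N g)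

def hypPoint (s : ℝ) (x : Fin 3 → ℝ) : Fin 4 → ℝ := spt (Real.sqrt (s^2 + ∑ i, x i ^ 2)) x
def hypL2Sq (s : ℝ) (φ : (Fin 4 → ℝ) → ℝ) : ℝ := ∫ x : Fin 3 → ℝ, (φ (hypPoint s x))^2
def hypEnergy (μ s : ℝ) (φ : (Fin 4 → ℝ) → ℝ) : ℝ :=
  ∫ x : Fin 3 → ℝ,
    ((pder 0 φ (hypPoint s x))^2 + ∑ a : Fin 3, (pder a.succ φ (hypPoint s x))^2
      + 2 * ∑ a : Fin 3, (x a / hypPoint s x 0) * pder 0 φ (hypPoint s x) * pder a.succ φ (hypPoint s x)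
      + μ^2 * (φ (hypPoint s x))^2)

def flatEnergy (μ t : ℝ) (φ : (Fin 4 → ℝ) → ℝ) : ℝ :=
  (∑ α : Fin 4, L2normSq (fun x => pder α φ (spt t x))) + μ^2 * L2normSq (fun x => φ (spt t x))

def Xnorm (N : ℕ) (δ m : ℝ) (φ ψ : (Fin 4 → ℝ) → ℝ) : ℝ :=
  (⨆ t : {t : ℝ // 2 ≤ t}, ∑ n ∈ Finset.range (N+1), ∑ Γs : Fin n → VF,
    (flatEnergy 1 t (applyComp Γs φ) + (t : ℝ) ^ (-δ) * flatEnergy 1 t (applyComp Γs ψ)))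
  + (⨆ s : {s : ℝ // 2 ≤ s}, ∑ n ∈ Finset.range (N - 5 + 1), ∑ Γs : Fin n → VF,
    (Real.sqrt (hypEnergy m s (applyComp Γs φ))
      + (s : ℝ) ^ (-δ) * Real.sqrt (hypEnergy 1 s (applyComp Γs ψ))))

/-! ### Spacetime slices and coordinate derivatives -/

theorem spt_eq_add_smul (t : ℝ) (x : Fin 3 → ℝ) :
    spt t x = spt 0 x + t • Pi.single 0 1 := by
  ext i
  refine Fin.cases ?_ (fun j => ?_) i <;> simp [spt]

/-- The spatial inclusion `x ↦ (0, x)` as a continuous linear map. -/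
def spatialIncl : (Fin 3 → ℝ) →L[ℝ] (Fin 4 → ℝ) :=
  ContinuousLinearMap.pi (Fin.cons 0 (fun a => ContinuousLinearMap.proj a))

theorem spt_eq_add_spatialIncl (t : ℝ) (x : Fin 3 → ℝ) :
    spt t x = spt t 0 + spatialIncl x := by
  ext i
  refine Fin.cases ?_ (fun j => ?_) i <;> simp [spt, spatialIncl]

theorem spatialIncl_single (a : Fin 3) :
    spatialIncl (Pi.single a 1) = Pi.single a.succ 1 := by
  ext i
  refine Fin.cases ?_ (fun j => ?_) i
  · simp [spatialIncl]
  · simp [spatialIncl, Pi.single_apply]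

@[simp] theorem spt_zero (t : ℝ) (x : Fin 3 → ℝ) : spt t x 0 = t := rfl

@[simp] theorem spt_succ (t : ℝ) (x : Fin 3 → ℝ) (a : Fin 3) : spt t x a.succ = x a := rfl

theorem spt_eta (y : Fin 4 → ℝ) : spt (y 0) (fun a => y a.succ) = y := by
  ext i
  refine Fin.cases ?_ (fun j => ?_) i <;> simp

theorem continuous_spt : Continuous (fun p : ℝ × (Fin 3 → ℝ) => spt p.1 p.2) := by
  refine continuous_pi fun i => ?_
  refine Fin.cases ?_ (fun j => ?_) i
  · simpa using continuous_fst
  · simp only [spt_succ]; fun_prop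

theorem continuous_spt_right (t : ℝ) : Continuous (spt t) :=
  continuous_spt.comp (Continuous.prodMk_right t)

theorem hasDerivAt_slice {φ : (Fin 4 → ℝ) → ℝ} (t : ℝ) (x : Fin 3 → ℝ)
    (h : DifferentiableAt ℝ φ (spt t x)) :
    HasDerivAt (fun s => φ (spt s x)) (pder 0 φ (spt t x)) t := by
  have h1 : HasDerivAt (fun s : ℝ => spt s x) (Pi.single 0 1) t := by
    have : HasDerivAt (fun s : ℝ => spt 0 x + s • (Pi.single 0 1 : Fin 4 → ℝ))
        ((1 : ℝ) • (Pi.single 0 1 : Fin 4 → ℝ)) t :=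
      ((hasDerivAt_id t).smul_const _).const_add _
    rw [one_smul] at this
    exact this.congr_of_eventuallyEq (Filter.Eventually.of_forall fun s => spt_eq_add_smul s x)
  exact h.hasFDerivAt.comp_hasDerivAt t h1

theorem hasFDerivAt_slice {φ : (Fin 4 → ℝ) → ℝ} (t : ℝ) (x : Fin 3 → ℝ)
    (h : DifferentiableAt ℝ φ (spt t x)) :
    HasFDerivAt (fun z => φ (spt t z)) ((fderiv ℝ φ (spt t x)).comp spatialIncl) x := by
  have h1 : HasFDerivAt (fun z => spt t z) spatialIncl x :=
    (spatialIncl.hasFDerivAt.const_add (spt t 0)).congr_of_eventuallyEq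
      (Filter.Eventually.of_forall fun z => spt_eq_add_spatialIncl t z)
  exact h.hasFDerivAt.comp x h1

theorem fderiv_slice_single {φ : (Fin 4 → ℝ) → ℝ} (hφ : Differentiable ℝ φ) (t : ℝ)
    (a : Fin 3) (x : Fin 3 → ℝ) :
    fderiv ℝ (fun z => φ (spt t z)) x (Pi.single a 1) = pder a.succ φ (spt t x) := by
  rw [(hasFDerivAt_slice t x (hφ _)).fderiv]
  simp [pder, spatialIncl_single]

theorem contDiff_pder {φ : (Fin 4 → ℝ) → ℝ} (h : ContDiff ℝ (⊤ : ℕ∞) φ) (α : Fin 4) :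
    ContDiff ℝ (⊤ : ℕ∞) (pder α φ) :=
  (h.fderiv_right (m := (⊤ : ℕ∞)) (by simp)).clm_apply contDiff_const

theorem pder_comm {φ : (Fin 4 → ℝ) → ℝ} (h : ContDiff ℝ (⊤ : ℕ∞) φ) (α β : Fin 4) :
    pder α (pder β φ) = pder β (pder α φ) := by
  ext y
  have hd : DifferentiableAt ℝ (fderiv ℝ φ) y :=
    ((h.fderiv_right (m := (⊤ : ℕ∞)) (by simp)).differentiable (by simp)) y
  have key : ∀ v w : Fin 4 → ℝ, fderiv ℝ (fun z => fderiv ℝ φ z v) y w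
      = fderiv ℝ (fderiv ℝ φ) y w v := fun v w => by
    rw [fderiv_clm_apply hd (differentiableAt_const v)]; simp
  change fderiv ℝ (fun z => fderiv ℝ φ z _) y _ = fderiv ℝ (fun z => fderiv ℝ φ z _) y _
  rw [key, key]
  exact (h.contDiffAt.isSymmSndFDerivAt
    (by simpa using WithTop.coe_le_coe.2 (le_top : (2 : ℕ∞) ≤ ⊤))) _ _

theorem pder_add {φ ψ : (Fin 4 → ℝ) → ℝ} {α : Fin 4} {y : Fin 4 → ℝ}
    (hφ : DifferentiableAt ℝ φ y) (hψ : DifferentiableAt ℝ ψ y) :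
    pder α (fun z => φ z + ψ z) y = pder α φ y + pder α ψ y := by
  simp [pder, fderiv_fun_add hφ hψ]

theorem pder_mul {φ ψ : (Fin 4 → ℝ) → ℝ} {α : Fin 4} {y : Fin 4 → ℝ}
    (hφ : DifferentiableAt ℝ φ y) (hψ : DifferentiableAt ℝ ψ y) :
    pder α (fun z => φ z * ψ z) y = pder α φ y * ψ y + φ y * pder α ψ y := by
  simp [pder, fderiv_fun_mul hφ hψ]; ring

theorem pder_const_mul {φ : (Fin 4 → ℝ) → ℝ} {α : Fin 4} {y : Fin 4 → ℝ} (c : ℝ)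
    (hφ : DifferentiableAt ℝ φ y) :
    pder α (fun z => c * φ z) y = c * pder α φ y := by
  simp [pder, fderiv_const_mul hφ c]

theorem pder_sq {φ : (Fin 4 → ℝ) → ℝ} {α : Fin 4} {y : Fin 4 → ℝ}
    (hφ : DifferentiableAt ℝ φ y) :
    pder α (fun z => φ z ^ 2) y = 2 * φ y * pder α φ y := by
  simp_rw [pow_two]; rw [pder_mul hφ hφ]; ring

theorem pder_sum {ι : Type*} (s : Finset ι) {φ : ι → (Fin 4 → ℝ) → ℝ} {α : Fin 4}
    {y : Fin 4 → ℝ} (hφ : ∀ i ∈ s, DifferentiableAt ℝ (φ i) y) :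
    pder α (fun z => ∑ i ∈ s, φ i z) y = ∑ i ∈ s, pder α (φ i) y := by
  simp [pder, fderiv_fun_sum hφ]

/-- On the slices with `t > 0` the function vanishes outside a fixed ball. -/
def SpatiallyBounded (φ : (Fin 4 → ℝ) → ℝ) : Prop :=
  ∃ ρ : ℝ, ∀ t : ℝ, 0 < t → ∀ x : Fin 3 → ℝ, ρ < ‖x‖ → φ (spt t x) = 0

theorem SpatiallyBounded.mul_right {φ : (Fin 4 → ℝ) → ℝ} (h : SpatiallyBounded φ)
    (ψ : (Fin 4 → ℝ) → ℝ) : SpatiallyBounded (fun y => φ y * ψ y) := by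
  obtain ⟨ρ, hρ⟩ := h
  exact ⟨ρ, fun t ht x hx => by simp [hρ t ht x hx]⟩

theorem SpatiallyBounded.pder_zero {φ : (Fin 4 → ℝ) → ℝ} (h : SpatiallyBounded φ)
    (hφ : Differentiable ℝ φ) : SpatiallyBounded (pder 0 φ) := by
  obtain ⟨ρ, hρ⟩ := h
  refine ⟨ρ, fun t ht x hx => ?_⟩
  have h1 := hasDerivAt_slice t x (hφ _)
  have h2 : HasDerivAt (fun s => φ (spt s x)) 0 t :=
    (hasDerivAt_const t (0 : ℝ)).congr_of_eventuallyEq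
      ((lt_mem_nhds ht).mono fun s hs => hρ s hs x hx)
  exact h1.unique h2

theorem hasCompactSupport_of_norm {g : (Fin 3 → ℝ) → ℝ} {ρ : ℝ}
    (h : ∀ x, ρ < ‖x‖ → g x = 0) : HasCompactSupport g :=
  HasCompactSupport.intro (isCompact_closedBall (0 : Fin 3 → ℝ) ρ) fun x hx =>
    h x (by simpa using hx)

theorem SpatiallyBounded.hasCompactSupport {φ : (Fin 4 → ℝ) → ℝ} (h : SpatiallyBounded φ)
    {t : ℝ} (ht : 0 < t) : HasCompactSupport (fun x => φ (spt t x)) :=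
  hasCompactSupport_of_norm (h.choose_spec t ht)

theorem SpatiallyBounded.integrable {φ : (Fin 4 → ℝ) → ℝ} (h : SpatiallyBounded φ)
    (hφ : Continuous φ) {t : ℝ} (ht : 0 < t) : Integrable (fun x => φ (spt t x)) :=
  (hφ.comp (continuous_spt_right t)).integrable_of_hasCompactSupport (h.hasCompactSupport ht)

theorem SpatiallyBounded.hasDerivAt_integral {φ : (Fin 4 → ℝ) → ℝ} (h : SpatiallyBounded φ)
    (hφ : ContDiff ℝ (⊤ : ℕ∞) φ) {t : ℝ} (ht : 0 < t) :
    HasDerivAt (fun s => ∫ x, φ (spt s x)) (∫ x, pder 0 φ (spt t x)) t := by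
  have hd : Differentiable ℝ φ := hφ.differentiable (by simp)
  have hc' : Continuous (pder 0 φ) := (contDiff_pder hφ 0).continuous
  obtain ⟨ρ, hρ⟩ := h.pder_zero hd
  have hK : IsCompact (Set.Icc (t / 2) (t + 1) ×ˢ Metric.closedBall (0 : Fin 3 → ℝ) ρ) :=
    isCompact_Icc.prod (isCompact_closedBall _ _)
  obtain ⟨M, hM⟩ := hK.exists_bound_of_continuousOn (hc'.comp continuous_spt).continuousOn
  refine (hasDerivAt_integral_of_dominated_loc_of_deriv_le (s := Set.Icc (t / 2) (t + 1))
    (bound := (Metric.closedBall (0 : Fin 3 → ℝ) ρ).indicator (fun _ => M))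
    (Icc_mem_nhds (by linarith) (by linarith))
    (Filter.Eventually.of_forall fun s =>
      (hφ.continuous.comp (continuous_spt_right s)).aestronglyMeasurable)
    (h.integrable hφ.continuous ht)
    (hc'.comp (continuous_spt_right t)).aestronglyMeasurable
    (Filter.Eventually.of_forall fun x s hs => ?_)
    ?_ (Filter.Eventually.of_forall fun x s _ => hasDerivAt_slice s x (hd _))).2
  · by_cases hx : x ∈ Metric.closedBall (0 : Fin 3 → ℝ) ρ
    · rw [Set.indicator_of_mem hx]
      exact hM (s, x) ⟨hs, hx⟩
    · rw [Set.indicator_of_notMem hx, hρ s (by linarith [hs.1]) x (by simpa using hx)]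
      simp
  · rw [integrable_indicator_iff measurableSet_closedBall]
    exact integrableOn_const (isCompact_closedBall _ _).measure_lt_top.ne

theorem SpatiallyBounded.integral_pder_succ {φ : (Fin 4 → ℝ) → ℝ} (h : SpatiallyBounded φ)
    (hφ : ContDiff ℝ (⊤ : ℕ∞) φ) {t : ℝ} (ht : 0 < t) (a : Fin 3) :
    ∫ x, pder a.succ φ (spt t x) = 0 := by
  have hd : Differentiable ℝ φ := hφ.differentiable (by simp)
  have hcs := h.hasCompactSupport ht
  have hfd : (fun x => fderiv ℝ (fun z => φ (spt t z)) x (Pi.single a 1))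
      = fun x => pder a.succ φ (spt t x) := by
    ext x; exact fderiv_slice_single hd t a x
  have hInt : Integrable (fun x => pder a.succ φ (spt t x)) := by
    refine ((contDiff_pder hφ a.succ).continuous.comp
      (continuous_spt_right t)).integrable_of_hasCompactSupport ?_
    have := hcs.fderiv_apply ℝ (Pi.single a 1)
    rwa [hfd] at this
  have := integral_mul_fderiv_eq_neg_fderiv_mul_of_integrable (μ := (volume : Measure (Fin 3 → ℝ)))
    (f := fun _ => (1 : ℝ)) (g := fun z => φ (spt t z)) (v := Pi.single a 1)
    (by simp) (by simp only [hfd, one_mul]; exact hInt)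
    (by simpa using h.integrable hφ.continuous ht) (fun x _ => differentiableAt_const _)
    (fun x _ => (hasFDerivAt_slice t x (hd _)).differentiableAt)
  simpa [hfd] using this

/-! ### The cone cutoff -/

/-- The Japanese bracket of the spatial part of a spacetime point. -/
def jap (y : Fin 4 → ℝ) : ℝ := Real.sqrt (1 + ∑ a : Fin 3, y a.succ ^ 2)

theorem jap_sq (y : Fin 4 → ℝ) : jap y ^ 2 = 1 + ∑ a : Fin 3, y a.succ ^ 2 :=
  Real.sq_sqrt (by positivity)

theorem one_le_jap (y : Fin 4 → ℝ) : 1 ≤ jap y :=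
  Real.one_le_sqrt.2 (by simpa using Finset.sum_nonneg fun a _ => sq_nonneg (y (Fin.succ a)))

theorem contDiff_jap : ContDiff ℝ (⊤ : ℕ∞) jap :=
  ContDiff.sqrt (by fun_prop) fun y => by positivity

theorem norm_le_jap (t : ℝ) (x : Fin 3 → ℝ) : ‖x‖ ≤ jap (spt t x) := by
  refine (pi_norm_le_iff_of_nonneg (Real.sqrt_nonneg _)).2 fun a => ?_
  refine Real.abs_le_sqrt ?_
  have := Finset.single_le_sum (f := fun a => x a ^ 2) (fun i _ => sq_nonneg (x i))
    (Finset.mem_univ a)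
  simp only [spt_succ]
  linarith

theorem pder_coord (α β : Fin 4) (y : Fin 4 → ℝ) :
    pder α (fun z => z β) y = if β = α then 1 else 0 := by
  have : fderiv ℝ (fun z : Fin 4 → ℝ => z β) y = ContinuousLinearMap.proj β :=
    (ContinuousLinearMap.proj (R := ℝ) (φ := fun _ : Fin 4 => ℝ) β).hasFDerivAt.fderiv
  rw [pder, this]
  simp [Pi.single_apply]

theorem jap_mul_pder_jap (α : Fin 4) (y : Fin 4 → ℝ) :
    jap y * pder α jap y = ∑ a : Fin 3, y a.succ * (if a.succ = α then 1 else 0) := by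
  have hd : DifferentiableAt ℝ jap y := contDiff_jap.differentiable (by simp) y
  have h1 := pder_sq (α := α) hd
  have h2 : pder α (fun z => jap z ^ 2) y
      = ∑ a : Fin 3, 2 * y a.succ * (if a.succ = α then 1 else 0) := by
    simp_rw [jap_sq]
    rw [pder_add (by fun_prop) (by fun_prop), pder_sum _ (fun i _ => by fun_prop)]
    simp_rw [fun i : Fin 3 => pder_sq (φ := fun z => z i.succ) (α := α) (y := y) (by fun_prop),
      pder_coord]
    simp [pder]
  rw [h1] at h2
  simp_rw [mul_assoc, ← Finset.mul_sum] at h2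
  linarith

theorem pder_zero_jap (y : Fin 4 → ℝ) : pder 0 jap y = 0 := by
  have h := jap_mul_pder_jap 0 y
  simp only [Fin.succ_ne_zero, if_false, mul_zero, Finset.sum_const_zero, mul_eq_zero] at h
  exact h.resolve_left (by linarith [one_le_jap y])

theorem pder_succ_jap (a : Fin 3) (y : Fin 4 → ℝ) : pder a.succ jap y = y a.succ / jap y := by
  have h := jap_mul_pder_jap a.succ y
  rw [eq_div_iff (by linarith [one_le_jap y]), mul_comm, h]
  simp

theorem deriv_smoothTransition_nonneg (s : ℝ) : 0 ≤ deriv Real.smoothTransition s :=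
  Real.smoothTransition.monotone.deriv_nonneg

theorem exists_deriv_smoothTransition_le :
    ∃ B : ℝ, 0 ≤ B ∧ ∀ s, deriv Real.smoothTransition s ≤ B := by
  have hc : Continuous (deriv Real.smoothTransition) :=
    (Real.smoothTransition.contDiff (n := 1)).continuous_deriv (by simp)
  obtain ⟨M, hM⟩ := (isCompact_Icc (a := (0 : ℝ)) (b := 1)).exists_bound_of_continuousOn
    hc.continuousOn
  refine ⟨max M 0, le_max_right _ _, fun s => ?_⟩
  by_cases hs : s ∈ Set.Icc (0 : ℝ) 1
  · exact (le_abs_self _).trans ((hM s hs).trans (le_max_left _ _))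
  · have h0 : deriv Real.smoothTransition s = 0 := by
      rw [Set.mem_Icc, not_and_or, not_le, not_le] at hs
      rcases hs with hs | hs
      · have : Real.smoothTransition =ᶠ[nhds s] fun _ => 0 :=
          (gt_mem_nhds hs).mono fun z hz => Real.smoothTransition.zero_of_nonpos hz.le
        rw [this.deriv_eq, deriv_const]
      · have : Real.smoothTransition =ᶠ[nhds s] fun _ => 1 :=
          (lt_mem_nhds hs).mono fun z hz => Real.smoothTransition.one_of_one_le hz.le
        rw [this.deriv_eq, deriv_const]
    rw [h0]; exact le_max_right _ _

/-- A smooth cutoff to `⟨x⟩ + t ≲ R`, monotone along the backward light cones. -/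
def cut (R : ℝ) (y : Fin 4 → ℝ) : ℝ := Real.smoothTransition (2 - (jap y + y 0) / R)

theorem contDiff_cut (R : ℝ) : ContDiff ℝ (⊤ : ℕ∞) (cut R) := by
  refine Real.smoothTransition.contDiff.comp ?_
  have := contDiff_jap
  fun_prop

theorem cut_nonneg (R : ℝ) (y : Fin 4 → ℝ) : 0 ≤ cut R y := Real.smoothTransition.nonneg _

theorem cut_le_one (R : ℝ) (y : Fin 4 → ℝ) : cut R y ≤ 1 := Real.smoothTransition.le_one _

theorem spatiallyBounded_cut {R : ℝ} (hR : 0 < R) : SpatiallyBounded (cut R) := by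
  refine ⟨2 * R, fun t ht x hx => Real.smoothTransition.zero_of_nonpos ?_⟩
  have h1 := norm_le_jap t x
  rw [sub_nonpos, le_div_iff₀ hR, spt_zero]
  linarith

theorem pder_cut (R : ℝ) (α : Fin 4) (y : Fin 4 → ℝ) :
    pder α (cut R) y = -(deriv Real.smoothTransition (2 - (jap y + y 0) / R) / R)
      * (pder α jap y + pder α (fun z => z 0) y) := by
  have hj : DifferentiableAt ℝ jap y := contDiff_jap.differentiable (by simp) y
  have hs : HasDerivAt Real.smoothTransition (deriv Real.smoothTransition
      (2 - (jap y + y 0) / R)) (2 - (jap y + y 0) / R) :=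
    ((Real.smoothTransition.contDiff (n := 1)).differentiable (by simp) _).hasDerivAt
  have h0 : DifferentiableAt ℝ (fun z : Fin 4 → ℝ => z 0) y := by fun_prop
  have hin : HasFDerivAt (fun z => 2 - (jap z + z 0) / R)
      (-(R⁻¹ • (fderiv ℝ jap y + fderiv ℝ (fun z : Fin 4 → ℝ => z 0) y))) y := by
    have := ((hj.hasFDerivAt.add h0.hasFDerivAt).const_mul R⁻¹).const_sub 2
    refine this.congr_of_eventuallyEq (Filter.Eventually.of_forall fun z => ?_)
    simp [div_eq_inv_mul]
  have := (hs.comp_hasFDerivAt y hin).fderiv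
  change fderiv ℝ (Real.smoothTransition ∘ fun z => 2 - (jap z + z 0) / R) y _ = _
  rw [this]
  simp [pder]
  ring

theorem pder_zero_cut (R : ℝ) (y : Fin 4 → ℝ) :
    pder 0 (cut R) y = -(deriv Real.smoothTransition (2 - (jap y + y 0) / R) / R) := by
  rw [pder_cut, pder_zero_jap, pder_coord]; simp

theorem pder_succ_cut (R : ℝ) (a : Fin 3) (y : Fin 4 → ℝ) :
    pder a.succ (cut R) y = pder 0 (cut R) y * (y a.succ / jap y) := by
  rw [pder_zero_cut, pder_cut, pder_succ_jap, pder_coord]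
  simp [(Fin.succ_ne_zero a).symm]

theorem pder_zero_cut_nonpos {R : ℝ} (hR : 0 < R) (y : Fin 4 → ℝ) : pder 0 (cut R) y ≤ 0 := by
  rw [pder_zero_cut, neg_nonpos]
  exact div_nonneg (deriv_smoothTransition_nonneg _) hR.le

theorem tendsto_cut (y : Fin 4 → ℝ) :
    Filter.Tendsto (fun n : ℕ => cut (n + 1) y) Filter.atTop (nhds 1) := by
  refine tendsto_const_nhds.congr' ?_
  obtain ⟨N, hN⟩ := exists_nat_ge (jap y + y 0)
  filter_upwards [Filter.eventually_ge_atTop N] with n hn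
  symm
  apply Real.smoothTransition.one_of_one_le
  have h1 : (N : ℝ) ≤ n := by exact_mod_cast hn
  have : (jap y + y 0) / (n + 1) ≤ 1 := by
    rw [div_le_one (by positivity)]; linarith
  linarith

/-- Removing the cutoff by Fatou's lemma. -/
theorem integrable_of_integral_cut_le {g : (Fin 3 → ℝ) → ℝ} (hg : Continuous g)
    (h0 : ∀ x, 0 ≤ g x) {t : ℝ} (ht : 0 < t) {c : ℕ → ℝ} {K : ℝ}
    (hc : Filter.Tendsto c Filter.atTop (nhds K))
    (h : ∀ n : ℕ, ∫ x, cut (n + 1) (spt t x) * g x ≤ c n) :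
    Integrable g ∧ ∫ x, g x ≤ K := by
  have hcont : ∀ n : ℕ, Continuous fun x => cut (n + 1) (spt t x) * g x := fun n =>
    ((contDiff_cut _).continuous.comp (continuous_spt_right t)).mul hg
  have hnn : ∀ (n : ℕ) x, 0 ≤ cut (n + 1) (spt t x) * g x := fun n x =>
    mul_nonneg (cut_nonneg _ _) (h0 x)
  have hInt : ∀ n : ℕ, Integrable fun x => cut (n + 1) (spt t x) * g x := fun n =>
    (hcont n).integrable_of_hasCompactSupport
      (((spatiallyBounded_cut (by positivity)).hasCompactSupport ht).mul_right)
  have hlim : ∀ x, Filter.Tendsto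
      (fun n : ℕ => ENNReal.ofReal (cut (n + 1) (spt t x) * g x)) Filter.atTop
      (nhds (ENNReal.ofReal (g x))) := fun x => by
    have := ((tendsto_cut (spt t x)).mul_const (g x))
    rw [one_mul] at this
    exact (ENNReal.continuous_ofReal.tendsto _).comp this
  have hK : 0 ≤ K := ge_of_tendsto' hc fun n => (integral_nonneg (hnn n)).trans (h n)
  have key : ∫⁻ x, ENNReal.ofReal (g x) ≤ ENNReal.ofReal K := by
    calc ∫⁻ x, ENNReal.ofReal (g x)
        = ∫⁻ x, Filter.liminf (fun n : ℕ => ENNReal.ofReal (cut (n + 1) (spt t x) * g x))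
            Filter.atTop := lintegral_congr fun x => (hlim x).liminf_eq.symm
      _ ≤ Filter.liminf (fun n : ℕ => ∫⁻ x, ENNReal.ofReal (cut (n + 1) (spt t x) * g x))
            Filter.atTop :=
          lintegral_liminf_le fun n => (hcont n).measurable.ennreal_ofReal
      _ ≤ Filter.liminf (fun n : ℕ => ENNReal.ofReal (c n)) Filter.atTop := by
          refine Filter.liminf_le_liminf (Filter.Eventually.of_forall fun n => ?_)
          rw [← ofReal_integral_eq_lintegral_ofReal (hInt n) (Filter.Eventually.of_forall (hnn n))]
          exact ENNReal.ofReal_le_ofReal (h n)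
      _ = ENNReal.ofReal K := ((ENNReal.continuous_ofReal.tendsto _).comp hc).liminf_eq
  have hI : Integrable g := by
    refine ⟨hg.aestronglyMeasurable, ?_⟩
    rw [hasFiniteIntegral_iff_ofReal (Filter.Eventually.of_forall h0)]
    exact key.trans_lt ENNReal.ofReal_lt_top
  refine ⟨hI, ?_⟩
  rw [← ofReal_integral_eq_lintegral_ofReal hI (Filter.Eventually.of_forall h0)] at key
  exact (ENNReal.ofReal_le_ofReal_iff hK).1 key

/-- The Cauchy–Schwarz inequality for continuous square integrable functions. -/
theorem integral_abs_mul_abs_le {f g : (Fin 3 → ℝ) → ℝ} (hf : Continuous f) (hg : Continuous g)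
    (hf2 : Integrable fun x => f x ^ 2) (hg2 : Integrable fun x => g x ^ 2) :
    Integrable (fun x => |f x| * |g x|) ∧
      ∫ x, |f x| * |g x| ≤ √(∫ x, f x ^ 2) * √(∫ x, g x ^ 2) := by
  have mf : MemLp f 2 := (memLp_two_iff_integrable_sq hf.aestronglyMeasurable).2 hf2
  have mg : MemLp g 2 := (memLp_two_iff_integrable_sq hg.aestronglyMeasurable).2 hg2
  refine ⟨mf.abs.integrable_mul mg.abs, ?_⟩
  have := integral_mul_norm_le_Lp_mul_Lq (μ := (volume : Measure (Fin 3 → ℝ))) (f := f) (g := g)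
    Real.HolderConjugate.two_two (by simpa using mf) (by simpa using mg)
  simpa [Real.sqrt_eq_rpow] using this

/-! ### Minkowski's inequality in time and Hardy's inequality in space -/

/-- Minkowski's integral inequality in differential form: a weighted `L²` norm grows at most at
the rate given by the weighted `L²` norm of the time derivative. -/
theorem integral_weight_mul_sq_le {G ρ : (Fin 4 → ℝ) → ℝ} (hG : ContDiff ℝ (⊤ : ℕ∞) G)
    (hρ : ContDiff ℝ (⊤ : ℕ∞) ρ) (hρ0 : ∀ y, 0 ≤ ρ y) (hρt : ∀ y, pder 0 ρ y = 0)
    {T A : ℝ} {P P' : ℝ → ℝ} (hA : 0 ≤ A)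
    (hP : ∀ t ∈ Set.Icc 2 T, HasDerivAt P (P' t) t) (hP' : ∀ t ∈ Set.Icc 2 T, 0 ≤ P' t)
    (hd : ∀ t ∈ Set.Icc 2 T, Integrable (fun x => ρ (spt t x) * pder 0 G (spt t x) ^ 2) ∧
      ∫ x, ρ (spt t x) * pder 0 G (spt t x) ^ 2 ≤ P' t ^ 2)
    (hi : Integrable fun x => ρ (spt 2 x) * G (spt 2 x) ^ 2)
    (hi' : ∫ x, ρ (spt 2 x) * G (spt 2 x) ^ 2 ≤ A ^ 2) {t : ℝ} (ht : t ∈ Set.Icc 2 T) :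
    Integrable (fun x => ρ (spt t x) * G (spt t x) ^ 2) ∧
      ∫ x, ρ (spt t x) * G (spt t x) ^ 2 ≤ (A + (P t - P 2)) ^ 2 := by
  have hGd : Differentiable ℝ G := hG.differentiable (by simp)
  have hρd : Differentiable ℝ ρ := hρ.differentiable (by simp)
  have hG' := contDiff_pder hG 0
  have ht0 : 0 < t := two_pos.trans_le ht.1
  have hc : Filter.Tendsto (fun n : ℕ => (A + 1 / ((n : ℝ) + 1) + (P t - P 2)) ^ 2) Filter.atTop
      (nhds ((A + (P t - P 2)) ^ 2)) := by
    have := ((tendsto_one_div_add_atTop_nhds_zero_nat (𝕜 := ℝ)).const_add A).add_const (P t - P 2)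
    simpa using this.pow 2
  refine integrable_of_integral_cut_le
    ((hρ.continuous.comp (continuous_spt_right t)).mul
      ((hG.continuous.comp (continuous_spt_right t)).pow 2))
    (fun x => mul_nonneg (hρ0 _) (sq_nonneg _)) ht0 hc fun n => ?_
  have hR : (0 : ℝ) < n + 1 := by positivity
  set ε : ℝ := 1 / ((n : ℝ) + 1) with hε
  have hεpos : 0 < ε := by positivity
  set Q : (Fin 4 → ℝ) → ℝ := fun y => cut (n + 1) y * (ρ y * G y ^ 2) with hQ
  have hQs : ContDiff ℝ (⊤ : ℕ∞) Q := (contDiff_cut _).mul (hρ.mul (hG.pow 2))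
  have hQb : SpatiallyBounded Q := (spatiallyBounded_cut hR).mul_right _
  have hQ0 : ∀ y, 0 ≤ Q y := fun y => mul_nonneg (cut_nonneg _ _) (mul_nonneg (hρ0 _) (sq_nonneg _))
  have hQ' : ∀ y, pder 0 Q y ≤ 2 * (cut (n + 1) y * (ρ y * (G y * pder 0 G y))) := fun y => by
    have hcd : DifferentiableAt ℝ (cut (n + 1)) y := (contDiff_cut _).differentiable (by simp) y
    rw [hQ, pder_mul hcd ((hρd y).fun_mul ((hGd y).fun_pow 2)),
      pder_mul (hρd y) ((hGd y).fun_pow 2), pder_sq (hGd y), hρt]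
    have := mul_nonneg (neg_nonneg.2 (pder_zero_cut_nonpos hR y))
      (mul_nonneg (hρ0 y) (sq_nonneg (G y)))
    linarith
  have hderiv : ∀ s ∈ Set.Icc 2 T, HasDerivAt (fun s => √((∫ x, Q (spt s x)) + ε ^ 2) - P s)
      ((∫ x, pder 0 Q (spt s x)) / (2 * √((∫ x, Q (spt s x)) + ε ^ 2)) - P' s) s := fun s hs => by
    have h1 := (hQb.hasDerivAt_integral hQs (t := s) (by linarith [hs.1])).add_const (ε ^ 2)
    refine (h1.sqrt ?_).sub (hP s hs)
    have : 0 ≤ ∫ x, Q (spt s x) := integral_nonneg fun x => hQ0 (spt s x)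
    positivity
  have hnonpos : ∀ s ∈ Set.Icc 2 T,
      (∫ x, pder 0 Q (spt s x)) / (2 * √((∫ x, Q (spt s x)) + ε ^ 2)) - P' s ≤ 0 := by
    intro s hs
    have hs0 : 0 < s := by linarith [hs.1]
    have hN : 0 ≤ ∫ x, Q (spt s x) := integral_nonneg fun x => hQ0 (spt s x)
    rw [sub_nonpos, div_le_iff₀ (by positivity)]
    set σ : (Fin 3 → ℝ) → ℝ := fun x => √(cut (n + 1) (spt s x) * ρ (spt s x)) with hσ
    have hσ2 : ∀ x, σ x ^ 2 = cut (n + 1) (spt s x) * ρ (spt s x) := fun x =>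
      Real.sq_sqrt (mul_nonneg (cut_nonneg _ _) (hρ0 _))
    have hσc : Continuous σ := (((contDiff_cut _).continuous.comp (continuous_spt_right s)).mul
      (hρ.continuous.comp (continuous_spt_right s))).sqrt
    have e1 : ∀ x, (σ x * G (spt s x)) ^ 2 = Q (spt s x) := fun x => by
      rw [mul_pow, hσ2, hQ]; ring
    have e2 : ∀ x, (σ x * pder 0 G (spt s x)) ^ 2
        = cut (n + 1) (spt s x) * (ρ (spt s x) * pder 0 G (spt s x) ^ 2) := fun x => by
      rw [mul_pow, hσ2]; ring
    have i2 : Integrable fun x =>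
        cut (n + 1) (spt s x) * (ρ (spt s x) * pder 0 G (spt s x) ^ 2) :=
      ((spatiallyBounded_cut hR).mul_right _).integrable
        ((contDiff_cut _).continuous.mul (hρ.continuous.mul (hG'.continuous.pow 2))) hs0
    have cs := integral_abs_mul_abs_le (f := fun x => σ x * G (spt s x))
      (g := fun x => σ x * pder 0 G (spt s x))
      (hσc.mul (hG.continuous.comp (continuous_spt_right s)))
      (hσc.mul (hG'.continuous.comp (continuous_spt_right s)))
      (by simp_rw [e1]; exact hQb.integrable hQs.continuous hs0)
      (by simp_rw [e2]; exact i2)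
    simp_rw [e1, e2] at cs
    have b1 : ∫ x, pder 0 Q (spt s x) ≤
        2 * ∫ x, |σ x * G (spt s x)| * |σ x * pder 0 G (spt s x)| := by
      rw [← integral_const_mul]
      refine integral_mono ((hQb.pder_zero (hQs.differentiable (by simp))).integrable
        (contDiff_pder hQs 0).continuous hs0) (cs.1.const_mul 2) fun x => ?_
      refine (hQ' _).trans ?_
      have : cut (n + 1) (spt s x) * (ρ (spt s x) * (G (spt s x) * pder 0 G (spt s x)))
          = (σ x * G (spt s x)) * (σ x * pder 0 G (spt s x)) := by
        linear_combination -(G (spt s x) * pder 0 G (spt s x)) * hσ2 x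
      rw [this, ← abs_mul]
      linarith [le_abs_self ((σ x * G (spt s x)) * (σ x * pder 0 G (spt s x)))]
    have b2 : √(∫ x, cut (n + 1) (spt s x) * (ρ (spt s x) * pder 0 G (spt s x) ^ 2)) ≤ P' s := by
      refine Real.sqrt_le_iff.2 ⟨hP' s hs, le_trans ?_ (hd s hs).2⟩
      exact integral_mono i2 (hd s hs).1 fun x => mul_le_of_le_one_left
        (mul_nonneg (hρ0 _) (sq_nonneg _)) (cut_le_one _ _)
    have b3 : √(∫ x, Q (spt s x)) ≤ √((∫ x, Q (spt s x)) + ε ^ 2) :=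
      Real.sqrt_le_sqrt (by linarith [sq_nonneg ε])
    have b4 := mul_le_mul b3 b2 (Real.sqrt_nonneg _) (Real.sqrt_nonneg _)
    linarith [cs.2]
  have hanti : AntitoneOn (fun s => √((∫ x, Q (spt s x)) + ε ^ 2) - P s) (Set.Icc 2 T) :=
    antitoneOn_of_hasDerivWithinAt_nonpos (convex_Icc _ _)
      (fun s hs => (hderiv s hs).continuousAt.continuousWithinAt)
      (fun s hs => (hderiv s (interior_subset hs)).hasDerivWithinAt)
      (fun s hs => hnonpos s (interior_subset hs))
  have h2 := hanti (Set.left_mem_Icc.2 (ht.1.trans ht.2)) ht ht.1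
  have hstart : √((∫ x, Q (spt 2 x)) + ε ^ 2) ≤ A + ε := by
    refine Real.sqrt_le_iff.2 ⟨by positivity, ?_⟩
    have : ∫ x, Q (spt 2 x) ≤ ∫ x, ρ (spt 2 x) * G (spt 2 x) ^ 2 :=
      integral_mono (hQb.integrable hQs.continuous two_pos) hi fun x => mul_le_of_le_one_left
        (mul_nonneg (hρ0 _) (sq_nonneg _)) (cut_le_one _ _)
    nlinarith [mul_nonneg hA hεpos.le]
  have hN : 0 ≤ ∫ x, Q (spt t x) := integral_nonneg fun x => hQ0 (spt t x)
  have hfin : √((∫ x, Q (spt t x)) + ε ^ 2) ≤ A + ε + (P t - P 2) := by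
    dsimp only at h2; linarith
  have := (Real.sqrt_le_iff.1 hfin).2
  change ∫ x, Q (spt t x) ≤ _
  linarith [sq_nonneg ε]

/-- The squared length of the spatial gradient. -/
def gradSq (w : (Fin 4 → ℝ) → ℝ) (y : Fin 4 → ℝ) : ℝ := ∑ a : Fin 3, pder a.succ w y ^ 2

theorem gradSq_nonneg (w : (Fin 4 → ℝ) → ℝ) (y : Fin 4 → ℝ) : 0 ≤ gradSq w y :=
  Finset.sum_nonneg fun _ _ => sq_nonneg _

theorem contDiff_gradSq {w : (Fin 4 → ℝ) → ℝ} (hw : ContDiff ℝ (⊤ : ℕ∞) w) :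
    ContDiff ℝ (⊤ : ℕ∞) (gradSq w) :=
  ContDiff.sum fun a _ => (contDiff_pder hw a.succ).pow 2

/-- The squared distance to the time axis. -/
def radSq (y : Fin 4 → ℝ) : ℝ := ∑ a : Fin 3, y a.succ ^ 2

theorem radSq_nonneg (y : Fin 4 → ℝ) : 0 ≤ radSq y := Finset.sum_nonneg fun _ _ => sq_nonneg _

theorem contDiff_radSq : ContDiff ℝ (⊤ : ℕ∞) radSq := by
  unfold radSq; fun_prop

theorem pder_radSq (α : Fin 4) (y : Fin 4 → ℝ) :
    pder α radSq y = ∑ a : Fin 3, 2 * y a.succ * (if a.succ = α then 1 else 0) := by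
  unfold radSq
  rw [pder_sum _ (fun i _ => by fun_prop)]
  simp_rw [fun i : Fin 3 => pder_sq (φ := fun z => z i.succ) (α := α) (y := y) (by fun_prop),
    pder_coord]

theorem radSq_spt (t : ℝ) (x : Fin 3 → ℝ) : radSq (spt t x) = rad x ^ 2 := by
  rw [rad, Real.sq_sqrt (Finset.sum_nonneg fun _ _ => sq_nonneg _)]; rfl

theorem contDiff_inv_radSq_add {ε : ℝ} (hε : 0 < ε) :
    ContDiff ℝ (⊤ : ℕ∞) fun y => (radSq y + ε)⁻¹ :=
  (contDiff_radSq.add contDiff_const).inv fun y => by linarith [radSq_nonneg y]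

theorem pder_inv_radSq_add {ε : ℝ} (hε : 0 < ε) (a : Fin 3) (y : Fin 4 → ℝ) :
    pder a.succ (fun y => (radSq y + ε)⁻¹) y = -(2 * y a.succ * (radSq y + ε)⁻¹ ^ 2) := by
  have hd : DifferentiableAt ℝ (fun y => (radSq y + ε)⁻¹) y :=
    (contDiff_inv_radSq_add hε).differentiable (by simp) y
  have hr : DifferentiableAt ℝ radSq y := contDiff_radSq.differentiable (by simp) y
  have hne : radSq y + ε ≠ 0 := by linarith [radSq_nonneg y]
  have h1 : pder a.succ (fun z => (radSq z + ε)⁻¹ * (radSq z + ε)) y = 0 := by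
    have : (fun z => (radSq z + ε)⁻¹ * (radSq z + ε)) = fun _ => 1 := by
      ext z; exact inv_mul_cancel₀ (by linarith [radSq_nonneg z])
    rw [this]; simp [pder]
  have h2 : pder a.succ (fun z => radSq z + ε) y = 2 * y a.succ := by
    rw [pder_add hr (differentiableAt_const _), pder_radSq]
    simp [pder]
  rw [pder_mul hd (hr.fun_add (differentiableAt_const _)), h2] at h1
  field_simp
  field_simp at h1
  linarith

/-- Hardy's inequality, with a regularised weight. -/
theorem hardy_inequality {w : (Fin 4 → ℝ) → ℝ} (hw : ContDiff ℝ (⊤ : ℕ∞) w) {t : ℝ} (ht : 0 < t)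
    (h0 : Integrable fun x => w (spt t x) ^ 2) (h1 : Integrable fun x => gradSq w (spt t x))
    {ε : ℝ} (hε : 0 < ε) :
    Integrable (fun x => (radSq (spt t x) + ε)⁻¹ * w (spt t x) ^ 2) ∧
      ∫ x, (radSq (spt t x) + ε)⁻¹ * w (spt t x) ^ 2 ≤ 4 * ∫ x, gradSq w (spt t x) := by
  obtain ⟨B, hB0, hB⟩ := exists_deriv_smoothTransition_le
  have hwd : Differentiable ℝ w := hw.differentiable (by simp)
  have hkinv := contDiff_inv_radSq_add hε
  have hc : Filter.Tendsto (fun n : ℕ => 4 * (∫ x, gradSq w (spt t x))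
      + 1 / ((n : ℝ) + 1) * (2 * B * ∫ x, w (spt t x) ^ 2)) Filter.atTop
      (nhds (4 * ∫ x, gradSq w (spt t x))) := by
    have := ((tendsto_one_div_add_atTop_nhds_zero_nat (𝕜 := ℝ)).mul_const
      (2 * B * ∫ x, w (spt t x) ^ 2)).const_add (4 * ∫ x, gradSq w (spt t x))
    simpa using this
  refine integrable_of_integral_cut_le
    ((hkinv.continuous.comp (continuous_spt_right t)).mul
      ((hw.continuous.comp (continuous_spt_right t)).pow 2))
    (fun x => mul_nonneg (inv_nonneg.2 (by linarith [radSq_nonneg (spt t x)])) (sq_nonneg _)) ht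
    hc fun n => ?_
  have hR : (0 : ℝ) < n + 1 := by positivity
  set k : (Fin 4 → ℝ) → ℝ := fun y => (radSq y + ε)⁻¹ with hk
  set X : Fin 3 → (Fin 4 → ℝ) → ℝ := fun a y => cut (n + 1) y * (y a.succ * (k y * w y ^ 2)) with hX
  have hXs : ∀ a, ContDiff ℝ (⊤ : ℕ∞) (X a) := fun a =>
    (contDiff_cut _).mul ((by fun_prop : ContDiff ℝ (⊤ : ℕ∞) fun y : Fin 4 → ℝ => y a.succ).mul
      (hkinv.mul (hw.pow 2)))
  have hXb : ∀ a, SpatiallyBounded (X a) := fun a => (spatiallyBounded_cut hR).mul_right _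
  have hX0 : ∀ a, ∫ x, pder a.succ (X a) (spt t x) = 0 := fun a =>
    (hXb a).integral_pder_succ (hXs a) ht a
  have hXi : ∀ a, Integrable fun x => pder a.succ (X a) (spt t x) := fun a => by
    refine ((contDiff_pder (hXs a) a.succ).continuous.comp
      (continuous_spt_right t)).integrable_of_hasCompactSupport ?_
    have := ((hXb a).hasCompactSupport ht).fderiv_apply ℝ (Pi.single a 1)
    simp only [fderiv_slice_single ((hXs a).differentiable (by simp))] at this
    exact this
  have hpt : ∀ y, cut (n + 1) y * (k y * w y ^ 2) ≤
      2 * (∑ a, pder a.succ (X a) y) + 4 * gradSq w y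
        + 1 / ((n : ℝ) + 1) * (2 * B) * w y ^ 2 := fun y => by
    have hcd : DifferentiableAt ℝ (cut (n + 1)) y := (contDiff_cut _).differentiable (by simp) y
    have hkd : DifferentiableAt ℝ k y := hkinv.differentiable (by simp) y
    have hpos : 0 < radSq y + ε := by linarith [radSq_nonneg y]
    have hkpos : 0 < k y := inv_pos.2 hpos
    have hkr : k y * radSq y ≤ 1 := by
      rw [hk]; dsimp only; rw [inv_mul_le_iff₀ hpos]; linarith
    have hXd : ∀ a : Fin 3, pder a.succ (X a) y = pder 0 (cut (n + 1)) y / jap y * k y * w y ^ 2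
          * y a.succ ^ 2 + cut (n + 1) y * k y * w y ^ 2
          - 2 * cut (n + 1) y * k y ^ 2 * w y ^ 2 * y a.succ ^ 2
          + 2 * cut (n + 1) y * k y * w y * (y a.succ * pder a.succ w y) := fun a => by
      have hyd : DifferentiableAt ℝ (fun z : Fin 4 → ℝ => z a.succ) y := by fun_prop
      rw [hX]
      dsimp only
      rw [pder_mul hcd (hyd.fun_mul (hkd.fun_mul ((hwd y).fun_pow 2))),
        pder_mul hyd (hkd.fun_mul ((hwd y).fun_pow 2)),
        pder_mul hkd ((hwd y).fun_pow 2), pder_sq (hwd y), pder_inv_radSq_add hε, pder_succ_cut,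
        pder_coord, if_pos rfl]
      ring
    have hsum : ∑ a, pder a.succ (X a) y = pder 0 (cut (n + 1)) y / jap y * k y * w y ^ 2 * radSq y
        + 3 * (cut (n + 1) y * k y * w y ^ 2)
        - 2 * cut (n + 1) y * k y ^ 2 * w y ^ 2 * radSq y
        + 2 * cut (n + 1) y * k y * w y * ∑ a : Fin 3, y a.succ * pder a.succ w y := by
      simp_rw [hXd, Finset.sum_add_distrib, Finset.sum_sub_distrib, Finset.sum_add_distrib,
        ← Finset.mul_sum, radSq]
      simp
      ring
    set S := ∑ a : Fin 3, y a.succ * pder a.succ w y with hS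
    have hCS : S ^ 2 ≤ radSq y * gradSq w y :=
      Finset.sum_mul_sq_le_sq_mul_sq Finset.univ (fun a : Fin 3 => y a.succ)
        (fun a : Fin 3 => pder a.succ w y)
    have hjap := one_le_jap y
    have hcut0 := cut_nonneg (n + 1) y
    have hcut1 := cut_le_one (n + 1) y
    have hη : -(pder 0 (cut (n + 1)) y / jap y) ≤ B / (n + 1) := by
      rw [pder_zero_cut, neg_div, neg_neg]
      calc _ ≤ deriv Real.smoothTransition (2 - (jap y + y 0) / (n + 1)) / (n + 1) :=
            div_le_self (div_nonneg (deriv_smoothTransition_nonneg _) hR.le) hjap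
        _ ≤ _ := div_le_div_of_nonneg_right (hB _) hR.le
    have hkr0 : 0 ≤ k y * radSq y := mul_nonneg hkpos.le (radSq_nonneg y)
    have t1 : -(pder 0 (cut (n + 1)) y / jap y * k y * w y ^ 2 * radSq y)
        ≤ B / (n + 1) * w y ^ 2 := by
      have e : -(pder 0 (cut (n + 1)) y / jap y * k y * w y ^ 2 * radSq y)
        = -(pder 0 (cut (n + 1)) y / jap y) * (k y * radSq y) * w y ^ 2 := by ring
      rw [e]
      refine mul_le_mul_of_nonneg_right ?_ (sq_nonneg _)
      have := mul_le_mul hη hkr hkr0 (div_nonneg hB0 hR.le)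
      linarith
    have t2 : 0 ≤ cut (n + 1) y * k y * w y ^ 2 * (1 - k y * radSq y) :=
      mul_nonneg (by positivity) (by linarith)
    have t3 : k y * S ^ 2 ≤ gradSq w y := by
      have g0 := gradSq_nonneg w y
      calc k y * S ^ 2 ≤ k y * (radSq y * gradSq w y) := mul_le_mul_of_nonneg_left hCS hkpos.le
        _ = (k y * radSq y) * gradSq w y := by ring
        _ ≤ _ := mul_le_of_le_one_left g0 hkr
    have t4 : cut (n + 1) y * (k y * S ^ 2) ≤ gradSq w y :=
      (mul_le_of_le_one_left (by positivity) hcut1).trans t3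
    have t5 : 0 ≤ cut (n + 1) y * k y * (w y + 2 * S) ^ 2 := by positivity
    have e6 : 1 / ((n : ℝ) + 1) * (2 * B) * w y ^ 2 = 2 * (B / (n + 1) * w y ^ 2) := by ring
    rw [hsum, e6]
    nlinarith [t1, t2, t4, t5]
  have hsumi : Integrable fun x => ∑ a, pder a.succ (X a) (spt t x) :=
    integrable_finsetSum _ fun a _ => hXi a
  calc ∫ x, cut (n + 1) (spt t x) * (k (spt t x) * w (spt t x) ^ 2)
      ≤ ∫ x, (2 * (∑ a, pder a.succ (X a) (spt t x)) + 4 * gradSq w (spt t x)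
        + 1 / ((n : ℝ) + 1) * (2 * B) * w (spt t x) ^ 2) := by
        refine integral_mono (((spatiallyBounded_cut hR).mul_right _).integrable
          ((contDiff_cut _).continuous.mul (hkinv.continuous.mul (hw.continuous.pow 2))) ht)
          (((hsumi.const_mul 2).add (h1.const_mul 4)).add (h0.const_mul _)) fun x => hpt _
    _ = _ := by
        rw [integral_add ((hsumi.const_mul 2).fun_add (h1.const_mul 4)) (h0.const_mul _),
          integral_add (hsumi.const_mul 2) (h1.const_mul 4), integral_const_mul,
          integral_const_mul, integral_const_mul, integral_finsetSum _ fun a _ => hXi a]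
        simp_rw [hX0]
        simp
        ring

/-- Hardy's inequality in dual form. -/
theorem integral_abs_mul_abs_le_gradSq {w g : (Fin 4 → ℝ) → ℝ} (hw : ContDiff ℝ (⊤ : ℕ∞) w)
    (hg : Continuous g) {t : ℝ} (ht : 0 < t)
    (h0 : Integrable fun x => w (spt t x) ^ 2) (h1 : Integrable fun x => gradSq w (spt t x))
    (g0 : Integrable fun x => g (spt t x) ^ 2)
    (g1 : Integrable fun x => radSq (spt t x) * g (spt t x) ^ 2) :
    ∫ x, |w (spt t x)| * |g (spt t x)| ≤
      2 * √(∫ x, gradSq w (spt t x)) * √(∫ x, radSq (spt t x) * g (spt t x) ^ 2) := by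
  have hlim : Filter.Tendsto (fun n : ℕ => 2 * √(∫ x, gradSq w (spt t x)) *
      √((∫ x, radSq (spt t x) * g (spt t x) ^ 2) + 1 / ((n : ℝ) + 1) * ∫ x, g (spt t x) ^ 2))
      Filter.atTop (nhds (2 * √(∫ x, gradSq w (spt t x)) *
        √(∫ x, radSq (spt t x) * g (spt t x) ^ 2))) := by
    have := ((tendsto_one_div_add_atTop_nhds_zero_nat (𝕜 := ℝ)).mul_const
      (∫ x, g (spt t x) ^ 2)).const_add (∫ x, radSq (spt t x) * g (spt t x) ^ 2)
    rw [zero_mul, add_zero] at this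
    exact this.sqrt.const_mul _
  refine ge_of_tendsto' hlim fun n => ?_
  set ε : ℝ := 1 / ((n : ℝ) + 1) with hε
  have hεpos : 0 < ε := by positivity
  have hpos : ∀ x, 0 < radSq (spt t x) + ε := fun x => by linarith [radSq_nonneg (spt t x)]
  obtain ⟨H1, H2⟩ := hardy_inequality hw ht h0 h1 hεpos
  have hD : Continuous fun x => √(radSq (spt t x) + ε) :=
    ((contDiff_radSq.continuous.comp (continuous_spt_right t)).add continuous_const).sqrt
  have hDi : Continuous fun x => (√(radSq (spt t x) + ε))⁻¹ :=
    hD.inv₀ fun x => (Real.sqrt_pos.2 (hpos x)).ne'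
  have e1 : ∀ x, ((√(radSq (spt t x) + ε))⁻¹ * w (spt t x)) ^ 2
      = (radSq (spt t x) + ε)⁻¹ * w (spt t x) ^ 2 := fun x => by
    rw [mul_pow, inv_pow, Real.sq_sqrt (hpos x).le]
  have e2 : ∀ x, (√(radSq (spt t x) + ε) * g (spt t x)) ^ 2
      = radSq (spt t x) * g (spt t x) ^ 2 + ε * g (spt t x) ^ 2 := fun x => by
    rw [mul_pow, Real.sq_sqrt (hpos x).le]; ring
  have e3 : ∀ x, |(√(radSq (spt t x) + ε))⁻¹ * w (spt t x)| * |√(radSq (spt t x) + ε) * g (spt t x)|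
      = |w (spt t x)| * |g (spt t x)| := fun x => by
    have := (Real.sqrt_pos.2 (hpos x))
    rw [abs_mul, abs_mul, abs_of_pos this, abs_of_pos (inv_pos.2 this)]
    field_simp
  have cs := (integral_abs_mul_abs_le
    (f := fun x => (√(radSq (spt t x) + ε))⁻¹ * w (spt t x))
    (g := fun x => √(radSq (spt t x) + ε) * g (spt t x))
    (hDi.mul (hw.continuous.comp (continuous_spt_right t)))
    (hD.mul (hg.comp (continuous_spt_right t)))
    (by simp_rw [e1]; exact H1) (by simp_rw [e2]; exact g1.add (g0.const_mul ε))).2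
  simp_rw [e1, e2, e3] at cs
  rw [integral_add g1 (g0.const_mul ε), integral_const_mul] at cs
  refine cs.trans (mul_le_mul_of_nonneg_right ?_ (Real.sqrt_nonneg _))
  calc √(∫ x, (radSq (spt t x) + ε)⁻¹ * w (spt t x) ^ 2)
      ≤ √(4 * ∫ x, gradSq w (spt t x)) := Real.sqrt_le_sqrt H2
    _ = 2 * √(∫ x, gradSq w (spt t x)) := by
        rw [Real.sqrt_mul (by norm_num), show (4 : ℝ) = 2 ^ 2 by norm_num,
          Real.sqrt_sq (by norm_num)]

/-! ### Energy estimates for a time primitive of the solution -/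

/-- The Klein–Gordon operator `-□ + m²`. -/
def kleinGordon (m : ℝ) (w : (Fin 4 → ℝ) → ℝ) (y : Fin 4 → ℝ) : ℝ := -Box w y + m ^ 2 * w y

theorem contDiff_box {w : (Fin 4 → ℝ) → ℝ} (hw : ContDiff ℝ (⊤ : ℕ∞) w) :
    ContDiff ℝ (⊤ : ℕ∞) (Box w) :=
  (contDiff_pder (contDiff_pder hw 0) 0).neg.add
    (ContDiff.sum fun a _ => contDiff_pder (contDiff_pder hw a.succ) a.succ)

theorem contDiff_kleinGordon {w : (Fin 4 → ℝ) → ℝ} (hw : ContDiff ℝ (⊤ : ℕ∞) w) (m : ℝ) :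
    ContDiff ℝ (⊤ : ℕ∞) (kleinGordon m w) :=
  (contDiff_box hw).neg.add (contDiff_const.mul hw)

/-- Twice the Klein–Gordon energy density. -/
def energyDensity (m : ℝ) (w : (Fin 4 → ℝ) → ℝ) (y : Fin 4 → ℝ) : ℝ :=
  pder 0 w y ^ 2 + (gradSq w y + m ^ 2 * w y ^ 2)

theorem contDiff_energyDensity {w : (Fin 4 → ℝ) → ℝ} (hw : ContDiff ℝ (⊤ : ℕ∞) w) (m : ℝ) :
    ContDiff ℝ (⊤ : ℕ∞) (energyDensity m w) :=
  ((contDiff_pder hw 0).pow 2).add ((contDiff_gradSq hw).add (contDiff_const.mul (hw.pow 2)))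

theorem energyDensity_nonneg (m : ℝ) (w : (Fin 4 → ℝ) → ℝ) (y : Fin 4 → ℝ) :
    0 ≤ energyDensity m w y :=
  add_nonneg (sq_nonneg _) (add_nonneg (gradSq_nonneg w y) (by positivity))

theorem sq_pder_zero_le_energyDensity (m : ℝ) (w : (Fin 4 → ℝ) → ℝ) (y : Fin 4 → ℝ) :
    pder 0 w y ^ 2 ≤ energyDensity m w y :=
  le_add_of_nonneg_right (add_nonneg (gradSq_nonneg w y) (by positivity))

theorem gradSq_le_energyDensity (m : ℝ) (w : (Fin 4 → ℝ) → ℝ) (y : Fin 4 → ℝ) :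
    gradSq w y ≤ energyDensity m w y := by
  have h1 := sq_nonneg (pder 0 w y)
  have h2 : 0 ≤ m ^ 2 * w y ^ 2 := by positivity
  unfold energyDensity; linarith

theorem pder_zero_energyDensity {w : (Fin 4 → ℝ) → ℝ} (hw : ContDiff ℝ (⊤ : ℕ∞) w) (m : ℝ)
    (y : Fin 4 → ℝ) :
    pder 0 (energyDensity m w) y = 2 * pder 0 w y * pder 0 (pder 0 w) y
      + (∑ a : Fin 3, 2 * pder a.succ w y * pder a.succ (pder 0 w) y
        + m ^ 2 * (2 * w y * pder 0 w y)) := by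
  have hd : ∀ {φ : (Fin 4 → ℝ) → ℝ}, ContDiff ℝ (⊤ : ℕ∞) φ → DifferentiableAt ℝ φ y :=
    fun h => h.differentiable (by simp) y
  unfold energyDensity
  rw [pder_add (hd ((contDiff_pder hw 0).pow 2))
    (hd ((contDiff_gradSq hw).add (contDiff_const.mul (hw.pow 2)))),
    pder_add (hd (contDiff_gradSq hw)) (hd (contDiff_const.mul (hw.pow 2))),
    pder_const_mul _ (hd (hw.pow 2)), pder_sq (hd hw), pder_sq (hd (contDiff_pder hw 0))]
  unfold gradSq
  rw [pder_sum _ fun a _ => hd ((contDiff_pder hw a.succ).pow 2)]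
  simp_rw [fun a : Fin 3 => pder_sq (α := 0) (hd (contDiff_pder hw a.succ)),
    fun a : Fin 3 => pder_comm hw 0 a.succ]

theorem gradSq_eq_zero {w : (Fin 4 → ℝ) → ℝ} (hw : ContDiff ℝ (⊤ : ℕ∞) w) {t : ℝ}
    (h : ∀ x, w (spt t x) = 0) (x : Fin 3 → ℝ) : gradSq w (spt t x) = 0 := by
  refine Finset.sum_eq_zero fun a _ => ?_
  rw [← fderiv_slice_single (hw.differentiable (by simp))]
  simp [h]

/-- The energy cut off along backward light cones is controlled by the source term. -/
theorem integral_pder_zero_cut_mul_energyDensity_le {w : (Fin 4 → ℝ) → ℝ}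
    (hw : ContDiff ℝ (⊤ : ℕ∞) w) (m : ℝ) {R t : ℝ} (hR : 0 < R) (ht : 0 < t) :
    ∫ x, pder 0 (fun y => cut R y * energyDensity m w y) (spt t x) ≤
      ∫ x, 2 * (cut R (spt t x) * (pder 0 w (spt t x) * kleinGordon m w (spt t x))) := by
  have hu := contDiff_pder hw 0
  have hcut := contDiff_cut R
  have hEs : ContDiff ℝ (⊤ : ℕ∞) fun y => cut R y * energyDensity m w y :=
    hcut.mul (contDiff_energyDensity hw m)
  set X : Fin 3 → (Fin 4 → ℝ) → ℝ := fun a y => cut R y * (pder 0 w y * pder a.succ w y) with hX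
  have hXs : ∀ a, ContDiff ℝ (⊤ : ℕ∞) (X a) := fun a =>
    hcut.mul (hu.mul (contDiff_pder hw a.succ))
  have hXb : ∀ a, SpatiallyBounded (X a) := fun a => (spatiallyBounded_cut hR).mul_right _
  have hXi : ∀ a, Integrable fun x => pder a.succ (X a) (spt t x) := fun a => by
    refine ((contDiff_pder (hXs a) a.succ).continuous.comp
      (continuous_spt_right t)).integrable_of_hasCompactSupport ?_
    have := ((hXb a).hasCompactSupport ht).fderiv_apply ℝ (Pi.single a 1)
    simp only [fderiv_slice_single ((hXs a).differentiable (by simp))] at this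
    exact this
  have hpt : ∀ y, pder 0 (fun y => cut R y * energyDensity m w y) y ≤
      2 * (∑ a, pder a.succ (X a) y) + 2 * (cut R y * (pder 0 w y * kleinGordon m w y)) := by
    intro y
    have hd : ∀ {φ : (Fin 4 → ℝ) → ℝ}, ContDiff ℝ (⊤ : ℕ∞) φ → DifferentiableAt ℝ φ y :=
      fun h => h.differentiable (by simp) y
    have hXd : ∀ a : Fin 3, pder a.succ (X a) y
        = pder 0 (cut R) y * pder 0 w y / jap y * (y a.succ * pder a.succ w y)
          + cut R y * (pder a.succ w y * pder a.succ (pder 0 w) y)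
          + cut R y * pder 0 w y * pder a.succ (pder a.succ w) y := fun a => by
      rw [hX]
      dsimp only
      rw [pder_mul (hd hcut) (hd (hu.mul (contDiff_pder hw a.succ))),
        pder_mul (hd hu) (hd (contDiff_pder hw a.succ)), pder_succ_cut]
      ring
    set S := ∑ a : Fin 3, y a.succ * pder a.succ w y with hS
    have hCS : S ^ 2 ≤ radSq y * gradSq w y :=
      Finset.sum_mul_sq_le_sq_mul_sq Finset.univ (fun a : Fin 3 => y a.succ)
        (fun a : Fin 3 => pder a.succ w y)
    have hjap := one_le_jap y
    have hj2 : jap y ^ 2 = 1 + radSq y := jap_sq y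
    have hSj : (S / jap y) ^ 2 ≤ gradSq w y := by
      rw [div_pow, div_le_iff₀ (by positivity), hj2]
      nlinarith [gradSq_nonneg w y]
    have hflux : 0 ≤ energyDensity m w y - 2 * pder 0 w y * (S / jap y) := by
      have h2 : 0 ≤ m ^ 2 * w y ^ 2 := by positivity
      unfold energyDensity
      nlinarith [sq_nonneg (pder 0 w y - S / jap y)]
    have hneg := mul_nonneg (neg_nonneg.2 (pder_zero_cut_nonpos hR y)) hflux
    rw [pder_mul (hd hcut) (hd (contDiff_energyDensity hw m)), pder_zero_energyDensity hw]
    simp_rw [hXd, Finset.sum_add_distrib, mul_assoc, ← Finset.mul_sum, kleinGordon, Box]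
    rw [← hS]
    have e : pder 0 (cut R) y * (2 * pder 0 w y * (S / jap y))
        = 2 * (pder 0 (cut R) y * pder 0 w y / jap y * S) := by ring
    linear_combination hneg + e
  have hKi : Integrable fun x =>
      2 * (cut R (spt t x) * (pder 0 w (spt t x) * kleinGordon m w (spt t x))) :=
    (((spatiallyBounded_cut hR).mul_right fun y => pder 0 w y * kleinGordon m w y).integrable
      (hcut.continuous.mul (hu.continuous.mul (contDiff_kleinGordon hw m).continuous)) ht).const_mul 2
  have hsumi : Integrable fun x => 2 * ∑ a, pder a.succ (X a) (spt t x) :=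
    (integrable_finsetSum _ fun a _ => hXi a).const_mul 2
  have hEb : SpatiallyBounded fun y => cut R y * energyDensity m w y :=
    (spatiallyBounded_cut hR).mul_right _
  refine (integral_mono ((hEb.pder_zero (hEs.differentiable (by simp))).integrable
    (contDiff_pder hEs 0).continuous ht) (hsumi.add hKi) fun x => hpt _).trans_eq ?_
  rw [integral_add' hsumi hKi, integral_const_mul, integral_finsetSum _ fun a _ => hXi a]
  simp [fun a => (hXb a).integral_pder_succ (hXs a) ht a]

/-- Local-in-time energy bound with a nonoptimal constant. -/
theorem integral_energyDensity_le {w : (Fin 4 → ℝ) → ℝ} (hw : ContDiff ℝ (⊤ : ℕ∞) w)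
    (m : ℝ) {T M : ℝ} (h0 : Integrable fun x => energyDensity m w (spt 2 x))
    (hF : ∀ t ∈ Set.Icc 2 T, Integrable (fun x => kleinGordon m w (spt t x) ^ 2) ∧
      ∫ x, kleinGordon m w (spt t x) ^ 2 ≤ M) {t : ℝ} (ht : t ∈ Set.Icc 2 T) :
    Integrable (fun x => energyDensity m w (spt t x)) ∧
      ∫ x, energyDensity m w (spt t x) ≤
        Real.exp T * ((∫ x, energyDensity m w (spt 2 x)) + M) := by
  have hu := contDiff_pder hw 0
  have hK := contDiff_kleinGordon hw m
  have hE := contDiff_energyDensity hw m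
  have ht0 : 0 < t := two_pos.trans_le ht.1
  have h2T : (2 : ℝ) ∈ Set.Icc 2 T := Set.left_mem_Icc.2 (ht.1.trans ht.2)
  have hM : 0 ≤ M := (integral_nonneg fun x => sq_nonneg _).trans (hF 2 h2T).2
  refine integrable_of_integral_cut_le (hE.continuous.comp (continuous_spt_right t))
    (fun x => energyDensity_nonneg _ _ _) ht0 tendsto_const_nhds fun n => ?_
  have hR : (0 : ℝ) < n + 1 := by positivity
  have hcut := contDiff_cut ((n : ℝ) + 1)
  set Q : (Fin 4 → ℝ) → ℝ := fun y => cut (n + 1) y * energyDensity m w y with hQ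
  have hQs : ContDiff ℝ (⊤ : ℕ∞) Q := hcut.mul hE
  have hQb : SpatiallyBounded Q := (spatiallyBounded_cut hR).mul_right _
  have hderiv : ∀ s ∈ Set.Icc 2 T,
      HasDerivAt (fun s => Real.exp (-s) * ((∫ x, Q (spt s x)) + M))
        (Real.exp (-s) * ((∫ x, pder 0 Q (spt s x)) - ((∫ x, Q (spt s x)) + M))) s := by
    intro s hs
    have h1 := (hQb.hasDerivAt_integral hQs (t := s) (by linarith [hs.1])).add_const M
    have h2 : HasDerivAt (fun s : ℝ => Real.exp (-s)) (-Real.exp (-s)) s := by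
      simpa using (hasDerivAt_neg s).exp
    exact (h2.fun_mul h1).congr_deriv (by ring)
  have hnonpos : ∀ s ∈ Set.Icc 2 T,
      Real.exp (-s) * ((∫ x, pder 0 Q (spt s x)) - ((∫ x, Q (spt s x)) + M)) ≤ 0 := by
    intro s hs
    have hs0 : 0 < s := by linarith [hs.1]
    refine mul_nonpos_of_nonneg_of_nonpos (Real.exp_pos _).le (sub_nonpos.2 ?_)
    refine (integral_pder_zero_cut_mul_energyDensity_le hw m hR hs0).trans ?_
    have hQi := hQb.integrable hQs.continuous hs0
    calc _ ≤ ∫ x, (Q (spt s x) + kleinGordon m w (spt s x) ^ 2) := by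
          refine integral_mono
            ((((spatiallyBounded_cut hR).mul_right fun y => pder 0 w y * kleinGordon m w y).integrable
              (hcut.continuous.mul (hu.continuous.mul hK.continuous)) hs0).const_mul 2)
            (hQi.add (hF s hs).1) fun x => ?_
          have c0 := cut_nonneg (n + 1) (spt s x)
          have c1 := mul_le_of_le_one_left (sq_nonneg (kleinGordon m w (spt s x)))
            (cut_le_one (n + 1) (spt s x))
          have c2 := mul_le_mul_of_nonneg_left
            (sq_pder_zero_le_energyDensity m w (spt s x)) c0
          have c3 := mul_nonneg c0 (sq_nonneg (pder 0 w (spt s x) - kleinGordon m w (spt s x)))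
          dsimp only [hQ, Q]
          nlinarith
      _ = (∫ x, Q (spt s x)) + ∫ x, kleinGordon m w (spt s x) ^ 2 :=
          integral_add hQi (hF s hs).1
      _ ≤ _ := by linarith [(hF s hs).2]
  have hanti : AntitoneOn (fun s => Real.exp (-s) * ((∫ x, Q (spt s x)) + M)) (Set.Icc 2 T) :=
    antitoneOn_of_hasDerivWithinAt_nonpos (convex_Icc _ _)
      (fun s hs => (hderiv s hs).continuousAt.continuousWithinAt)
      (fun s hs => (hderiv s (interior_subset hs)).hasDerivWithinAt)
      (fun s hs => hnonpos s (interior_subset hs))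
  have h2 := hanti h2T ht ht.1
  dsimp only at h2
  have hstart : ∫ x, Q (spt 2 x) ≤ ∫ x, energyDensity m w (spt 2 x) :=
    integral_mono (hQb.integrable hQs.continuous two_pos) h0 fun x => mul_le_of_le_one_left
      (energyDensity_nonneg _ _ _) (cut_le_one _ _)
  have hstart0 : 0 ≤ ∫ x, energyDensity m w (spt 2 x) :=
    integral_nonneg fun x => energyDensity_nonneg _ _ _
  have h3 : Real.exp (-t) * ((∫ x, Q (spt t x)) + M) ≤
      (∫ x, energyDensity m w (spt 2 x)) + M :=
    h2.trans ((mul_le_mul_of_nonneg_left (add_le_add_left hstart M) (Real.exp_pos _).le).trans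
      (mul_le_of_le_one_left (by positivity) (Real.exp_le_one_iff.2 (by norm_num))))
  rw [Real.exp_neg, inv_mul_le_iff₀ (Real.exp_pos t)] at h3
  have h4 : Real.exp t * ((∫ x, energyDensity m w (spt 2 x)) + M)
      ≤ Real.exp T * ((∫ x, energyDensity m w (spt 2 x)) + M) :=
    mul_le_mul_of_nonneg_right (Real.exp_le_exp.2 ht.2) (by positivity)
  change ∫ x, Q (spt t x) ≤ _
  linarith

/-- The energy is controlled by the initial energy and, through Hardy's inequality, by the product
of a bound `S` for the spatial gradient with the weighted norms of the source. -/
theorem integral_energyDensity_le_of_gradSq_le {w : (Fin 4 → ℝ) → ℝ}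
    (hw : ContDiff ℝ (⊤ : ℕ∞) w) (m : ℝ) {T S A : ℝ} {P P' : ℝ → ℝ} (hA : 0 ≤ A)
    (hP : ∀ t ∈ Set.Icc 2 T, HasDerivAt P (P' t) t) (hP' : ∀ t ∈ Set.Icc 2 T, 0 ≤ P' t)
    (hw0 : ∀ x, w (spt 2 x) = 0)
    (hw2 : ∀ t ∈ Set.Icc 2 T, Integrable fun x => w (spt t x) ^ 2)
    (hE : ∀ t ∈ Set.Icc 2 T, Integrable fun x => energyDensity m w (spt t x))
    (hF : ∀ t ∈ Set.Icc 2 T, Integrable fun x => kleinGordon m w (spt t x) ^ 2)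
    (hFr : ∀ t ∈ Set.Icc 2 T,
      Integrable (fun x => radSq (spt t x) * kleinGordon m w (spt t x) ^ 2) ∧
      ∫ x, radSq (spt t x) * kleinGordon m w (spt t x) ^ 2 ≤ (A + (P t - P 2)) ^ 2)
    (hf : ∀ t ∈ Set.Icc 2 T, Integrable fun x => pder 0 (kleinGordon m w) (spt t x) ^ 2)
    (hfr : ∀ t ∈ Set.Icc 2 T,
      Integrable (fun x => radSq (spt t x) * pder 0 (kleinGordon m w) (spt t x) ^ 2) ∧
      ∫ x, radSq (spt t x) * pder 0 (kleinGordon m w) (spt t x) ^ 2 ≤ P' t ^ 2)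
    (hS0 : 0 ≤ S) (hS : ∀ t ∈ Set.Icc 2 T, √(∫ x, gradSq w (spt t x)) ≤ S)
    {t : ℝ} (ht : t ∈ Set.Icc 2 T) :
    ∫ x, energyDensity m w (spt t x) ≤
      (∫ x, pder 0 w (spt 2 x) ^ 2) + 8 * S * (A + (P T - P 2)) := by
  obtain ⟨B, hB0, hB⟩ := exists_deriv_smoothTransition_le
  have hu := contDiff_pder hw 0
  have hK := contDiff_kleinGordon hw m
  have hK' := contDiff_pder hK 0
  have hEs := contDiff_energyDensity hw m
  have ht0 : 0 < t := two_pos.trans_le ht.1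
  have h2T : (2 : ℝ) ∈ Set.Icc 2 T := Set.left_mem_Icc.2 (ht.1.trans ht.2)
  have hTT : T ∈ Set.Icc 2 T := Set.right_mem_Icc.2 (ht.1.trans ht.2)
  have hPm : MonotoneOn P (Set.Icc 2 T) :=
    monotoneOn_of_hasDerivWithinAt_nonneg (convex_Icc _ _)
      (fun s hs => (hP s hs).continuousAt.continuousWithinAt)
      (fun s hs => (hP s (interior_subset hs)).hasDerivWithinAt)
      (fun s hs => hP' s (interior_subset hs))
  have hgi : ∀ s ∈ Set.Icc 2 T, Integrable fun x => gradSq w (spt s x) := fun s hs =>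
    (hE s hs).mono' ((contDiff_gradSq hw).continuous.comp
      (continuous_spt_right s)).aestronglyMeasurable (Filter.Eventually.of_forall fun x => by
        rw [Real.norm_of_nonneg (gradSq_nonneg _ _)]; exact gradSq_le_energyDensity m w _)
  have hwFi : ∀ s ∈ Set.Icc 2 T,
      Integrable fun x => |w (spt s x)| * |kleinGordon m w (spt s x)| := fun s hs =>
    (integral_abs_mul_abs_le (hw.continuous.comp (continuous_spt_right s))
      (hK.continuous.comp (continuous_spt_right s)) (hw2 s hs) (hF s hs)).1
  have hwfi : ∀ s ∈ Set.Icc 2 T,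
      Integrable fun x => |w (spt s x)| * |pder 0 (kleinGordon m w) (spt s x)| := fun s hs =>
    (integral_abs_mul_abs_le (hw.continuous.comp (continuous_spt_right s))
      (hK'.continuous.comp (continuous_spt_right s)) (hw2 s hs) (hf s hs)).1
  have hwF : ∀ s ∈ Set.Icc 2 T, ∫ x, |w (spt s x)| * |kleinGordon m w (spt s x)|
      ≤ 2 * S * (A + (P s - P 2)) := fun s hs => by
    refine (integral_abs_mul_abs_le_gradSq hw hK.continuous (by linarith [hs.1]) (hw2 s hs)
      (hgi s hs) (hF s hs) (hFr s hs).1).trans ?_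
    have hP2 := hPm h2T hs hs.1
    refine mul_le_mul (by linarith [hS s hs]) (Real.sqrt_le_iff.2 ⟨by linarith, (hFr s hs).2⟩)
      (Real.sqrt_nonneg _) (by positivity)
  have hwf : ∀ s ∈ Set.Icc 2 T, ∫ x, |w (spt s x)| * |pder 0 (kleinGordon m w) (spt s x)|
      ≤ 2 * S * P' s := fun s hs => by
    refine (integral_abs_mul_abs_le_gradSq hw hK'.continuous (by linarith [hs.1]) (hw2 s hs)
      (hgi s hs) (hf s hs) (hfr s hs).1).trans ?_
    refine mul_le_mul (by linarith [hS s hs]) (Real.sqrt_le_iff.2 ⟨hP' s hs, (hfr s hs).2⟩)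
      (Real.sqrt_nonneg _) (by positivity)
  set L : ℝ := 2 * S * (A + (P T - P 2)) with hL
  have hlim : Filter.Tendsto (fun n : ℕ => (∫ x, pder 0 w (spt 2 x) ^ 2)
      + 8 * S * (A + (P T - P 2)) + 1 / ((n : ℝ) + 1) * (2 * B * L * (t - 2))) Filter.atTop
      (nhds ((∫ x, pder 0 w (spt 2 x) ^ 2) + 8 * S * (A + (P T - P 2)))) := by
    have := ((tendsto_one_div_add_atTop_nhds_zero_nat (𝕜 := ℝ)).mul_const
      (2 * B * L * (t - 2))).const_add
        ((∫ x, pder 0 w (spt 2 x) ^ 2) + 8 * S * (A + (P T - P 2)))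
    simpa using this
  refine (integrable_of_integral_cut_le (hEs.continuous.comp (continuous_spt_right t))
    (fun x => energyDensity_nonneg _ _ _) ht0 hlim fun n => ?_).2
  have hR : (0 : ℝ) < n + 1 := by positivity
  have hcut := contDiff_cut ((n : ℝ) + 1)
  have hcb := spatiallyBounded_cut hR
  set Q₁ : (Fin 4 → ℝ) → ℝ := fun y => cut (n + 1) y * energyDensity m w y with hQ₁
  set Q₂ : (Fin 4 → ℝ) → ℝ := fun y => cut (n + 1) y * (w y * kleinGordon m w y) with hQ₂
  have hQ₁s : ContDiff ℝ (⊤ : ℕ∞) Q₁ := hcut.mul hEs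
  have hQ₁b : SpatiallyBounded Q₁ := hcb.mul_right _
  have hQ₂s : ContDiff ℝ (⊤ : ℕ∞) Q₂ := hcut.mul (hw.mul hK)
  have hQ₂b : SpatiallyBounded Q₂ := hcb.mul_right _
  have hderiv : ∀ s ∈ Set.Icc 2 T,
      HasDerivAt (fun s => (∫ x, Q₁ (spt s x)) - 2 * (∫ x, Q₂ (spt s x)) - 4 * S * P s
          - 1 / ((n : ℝ) + 1) * (2 * B * L) * s)
        ((∫ x, pder 0 Q₁ (spt s x)) - 2 * (∫ x, pder 0 Q₂ (spt s x)) - 4 * S * P' s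
          - 1 / ((n : ℝ) + 1) * (2 * B * L)) s := fun s hs => by
    have hs0 : 0 < s := by linarith [hs.1]
    exact ((((hQ₁b.hasDerivAt_integral hQ₁s hs0).fun_sub
      ((hQ₂b.hasDerivAt_integral hQ₂s hs0).const_mul 2)).fun_sub
        ((hP s hs).const_mul (4 * S))).fun_sub
      ((hasDerivAt_id s).const_mul (1 / ((n : ℝ) + 1) * (2 * B * L)))).congr_deriv
        (by rw [mul_one])
  have hnonpos : ∀ s ∈ Set.Icc 2 T,
      (∫ x, pder 0 Q₁ (spt s x)) - 2 * (∫ x, pder 0 Q₂ (spt s x)) - 4 * S * P' s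
          - 1 / ((n : ℝ) + 1) * (2 * B * L) ≤ 0 := by
    intro s hs
    have hs0 : 0 < s := by linarith [hs.1]
    have k1 := integral_pder_zero_cut_mul_energyDensity_le hw m hR hs0
    have i1 : Integrable fun x =>
        2 * (cut (n + 1) (spt s x) * (pder 0 w (spt s x) * kleinGordon m w (spt s x))) :=
      ((hcb.mul_right fun y => pder 0 w y * kleinGordon m w y).integrable
        (hcut.continuous.mul (hu.continuous.mul hK.continuous)) hs0).const_mul 2
    have i2 : Integrable fun x => 2 * pder 0 Q₂ (spt s x) :=
      ((hQ₂b.pder_zero (hQ₂s.differentiable (by simp))).integrable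
        (contDiff_pder hQ₂s 0).continuous hs0).const_mul 2
    have i3 : Integrable fun x => 1 / ((n : ℝ) + 1) * (2 * B)
        * (|w (spt s x)| * |kleinGordon m w (spt s x)|) := (hwFi s hs).const_mul _
    have i4 : Integrable fun x => 2 * (|w (spt s x)| * |pder 0 (kleinGordon m w) (spt s x)|) :=
      (hwfi s hs).const_mul 2
    have hpt : ∀ y, 2 * (cut (n + 1) y * (pder 0 w y * kleinGordon m w y)) ≤
        2 * pder 0 Q₂ y + (1 / ((n : ℝ) + 1) * (2 * B) * (|w y| * |kleinGordon m w y|)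
          + 2 * (|w y| * |pder 0 (kleinGordon m w) y|)) := fun y => by
      have hd : ∀ {φ : (Fin 4 → ℝ) → ℝ}, ContDiff ℝ (⊤ : ℕ∞) φ → DifferentiableAt ℝ φ y :=
        fun h => h.differentiable (by simp) y
      rw [hQ₂, pder_mul (hd hcut) (hd (hw.mul hK)), pder_mul (hd hw) (hd hK)]
      have a1 : -(pder 0 (cut (n + 1)) y * (w y * kleinGordon m w y)) ≤
          B / (n + 1) * (|w y| * |kleinGordon m w y|) := by
        rw [← neg_mul, pder_zero_cut, neg_neg, ← abs_mul]
        refine (mul_le_mul_of_nonneg_left (le_abs_self _)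
          (div_nonneg (deriv_smoothTransition_nonneg _) hR.le)).trans ?_
        exact mul_le_mul_of_nonneg_right (div_le_div_of_nonneg_right (hB _) hR.le) (abs_nonneg _)
      have a2 : -(cut (n + 1) y * (w y * pder 0 (kleinGordon m w) y)) ≤
          |w y| * |pder 0 (kleinGordon m w) y| := by
        rw [← mul_neg, ← abs_mul]
        refine (mul_le_mul_of_nonneg_left (neg_le_abs _) (cut_nonneg _ _)).trans ?_
        exact mul_le_of_le_one_left (abs_nonneg _) (cut_le_one _ _)
      have e : 1 / ((n : ℝ) + 1) * (2 * B) * (|w y| * |kleinGordon m w y|)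
          = 2 * (B / (n + 1) * (|w y| * |kleinGordon m w y|)) := by ring
      rw [e]
      linarith
    have k2 := integral_mono i1 (i2.add (i3.add i4)) fun x => hpt (spt s x)
    rw [integral_add' i2 (i3.add i4), integral_add' i3 i4, integral_const_mul 2 (fun x => pder 0 Q₂ _),
      integral_const_mul (1 / ((n : ℝ) + 1) * (2 * B)),
      integral_const_mul 2 (fun x => |w _| * _)] at k2
    have k3 : ∫ x, |w (spt s x)| * |kleinGordon m w (spt s x)| ≤ L := by
      refine (hwF s hs).trans (mul_le_mul_of_nonneg_left ?_ (by positivity))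
      linarith [hPm hs hTT hs.2]
    have k4 := mul_le_mul_of_nonneg_left k3
      (show 0 ≤ 1 / ((n : ℝ) + 1) * (2 * B) by positivity)
    have k5 := hwf s hs
    linarith
  have hanti := antitoneOn_of_hasDerivWithinAt_nonpos (convex_Icc _ _)
      (fun s hs => (hderiv s hs).continuousAt.continuousWithinAt)
      (fun s hs => (hderiv s (interior_subset hs)).hasDerivWithinAt)
      (fun s hs => hnonpos s (interior_subset hs))
  have h2 := hanti h2T ht ht.1
  dsimp only at h2
  have hst2 : ∫ x, Q₂ (spt 2 x) = 0 := by simp [hQ₂, hw0]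
  have hE2 : ∀ x, energyDensity m w (spt 2 x) = pder 0 w (spt 2 x) ^ 2 := fun x => by
    simp [energyDensity, hw0, gradSq_eq_zero hw hw0]
  have hst1 : ∫ x, Q₁ (spt 2 x) ≤ ∫ x, pder 0 w (spt 2 x) ^ 2 := by
    have := integral_mono (hQ₁b.integrable hQ₁s.continuous two_pos) (hE 2 h2T) fun x =>
      mul_le_of_le_one_left (energyDensity_nonneg m w (spt 2 x)) (cut_le_one ((n : ℝ) + 1) _)
    simpa only [hE2] using this
  have hend : ∫ x, Q₂ (spt t x) ≤ 2 * S * (A + (P t - P 2)) := by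
    refine le_trans (integral_mono (hQ₂b.integrable hQ₂s.continuous ht0) (hwFi t ht)
      fun x => ?_) (hwF t ht)
    dsimp only [hQ₂, Q₂]
    rw [← abs_mul]
    exact (mul_le_mul_of_nonneg_left (le_abs_self _) (cut_nonneg _ _)).trans
      (mul_le_of_le_one_left (abs_nonneg _) (cut_le_one _ _))
  have hmono := hPm ht hTT ht.2
  have hmono2 := hPm h2T ht ht.1
  have f1 : S * (P t - P 2) ≤ S * (P T - P 2) := mul_le_mul_of_nonneg_left (by linarith) hS0
  have f2 := mul_nonneg hS0 hA
  change ∫ x, Q₁ (spt t x) ≤ _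
  rw [hst2] at h2
  have e3 : 1 / ((n : ℝ) + 1) * (2 * B * L * (t - 2)) = 1 / ((n : ℝ) + 1) * (2 * B * L) * t
    - 1 / ((n : ℝ) + 1) * (2 * B * L) * 2 := by ring
  rw [e3]
  linarith

/-! ### The time primitive -/

/-- Integrating a smooth function over the unit interval gives a smooth function of the
parameter. -/
theorem contDiff_integral_unitInterval {Y : Type*} [NormedAddCommGroup Y] [NormedSpace ℝ Y]
    {h : Y × ℝ → ℝ} (hh : ContDiff ℝ (⊤ : ℕ∞) h) :
    ContDiff ℝ (⊤ : ℕ∞) fun y => ∫ σ in (0 : ℝ)..1, h (y, σ) := by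
  set g : Y → ℝ → ℝ := fun y s =>
    Real.smoothTransition (2 + s) * Real.smoothTransition (2 - s) * h (y, -s) with hg
  have hgs : ContDiff ℝ (⊤ : ℕ∞) (fun p : Y × ℝ => g p.1 p.2) := by
    refine ContDiff.mul (ContDiff.mul ?_ ?_) (hh.comp (by fun_prop))
    · exact Real.smoothTransition.contDiff.comp (by fun_prop)
    · exact Real.smoothTransition.contDiff.comp (by fun_prop)
  have hsupp : ∀ p s, p ∈ (Set.univ : Set Y) → s ∉ Set.Icc (-2 : ℝ) 2 → g p s = 0 := by
    intro p s _ hs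
    rw [Set.mem_Icc, not_and_or, not_le, not_le] at hs
    rcases hs with hs | hs
    · simp [hg, Real.smoothTransition.zero_of_nonpos (show 2 + s ≤ 0 by linarith)]
    · simp [hg, Real.smoothTransition.zero_of_nonpos (show 2 - s ≤ 0 by linarith)]
  have hf : LocallyIntegrable (Set.indicator (Set.Ioc (0 : ℝ) 1) fun _ => (1 : ℝ)) :=
    ((integrable_indicator_iff measurableSet_Ioc).2 (by simp)).locallyIntegrable
  have key := contDiffOn_convolution_right_with_param (n := ⊤) (ContinuousLinearMap.mul ℝ ℝ)
    isOpen_univ isCompact_Icc hsupp hf (by exact hgs.contDiffOn)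
  rw [Set.univ_prod_univ, contDiffOn_univ] at key
  have key2 := key.comp (contDiff_id.prodMk (contDiff_const (c := (0 : ℝ))))
  convert key2 using 1
  ext y
  simp only [Function.comp_def, convolution_def, ContinuousLinearMap.mul_apply', id]
  rw [intervalIntegral.integral_of_le zero_le_one, ← integral_indicator measurableSet_Ioc]
  congr 1
  ext t
  by_cases ht : t ∈ Set.Ioc (0 : ℝ) 1
  · have h1 := Real.smoothTransition.one_of_one_le (show 1 ≤ 2 + (0 - t) by linarith [ht.2])
    have h2 := Real.smoothTransition.one_of_one_le (show 1 ≤ 2 - (0 - t) by linarith [ht.1])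
    simp only [Set.indicator_of_mem ht, hg, h1, h2]
    simp
  · simp [Set.indicator_of_notMem ht]

/-- Smooth functions on spacetime have smooth time primitives vanishing at `t = 2`. -/
theorem exists_pder_zero_eq {u : (Fin 4 → ℝ) → ℝ} (hu : ContDiff ℝ (⊤ : ℕ∞) u) :
    ∃ w : (Fin 4 → ℝ) → ℝ, ContDiff ℝ (⊤ : ℕ∞) w ∧ (∀ y, pder 0 w y = u y) ∧
      ∀ x, w (spt 2 x) = 0 := by
  set h : (Fin 4 → ℝ) × ℝ → ℝ := fun p =>
    (p.1 0 - 2) * u (p.1 + ((1 - p.2) * (2 - p.1 0)) • Pi.single 0 1) with hh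
  have hhs : ContDiff ℝ (⊤ : ℕ∞) h := by
    refine ContDiff.mul (by fun_prop) (hu.comp ?_)
    fun_prop
  have hw := contDiff_integral_unitInterval hhs
  have hspt : ∀ t x, ∫ σ in (0 : ℝ)..1, h (spt t x, σ) = ∫ s in (2 : ℝ)..t, u (spt s x) := by
    intro t x
    have := intervalIntegral.smul_integral_comp_add_mul (a := 0) (b := 1)
      (fun s => u (spt s x)) (t - 2) 2
    simp only [mul_zero, add_zero, mul_one, smul_eq_mul, add_sub_cancel] at this
    rw [← this, ← intervalIntegral.integral_const_mul]
    congr 1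
    ext σ
    simp only [hh, spt_zero]
    congr 2
    rw [spt_eq_add_smul t, spt_eq_add_smul (2 + _), add_assoc, ← add_smul]
    congr 2
    ring
  refine ⟨_, hw, fun y => ?_, fun x => by rw [hspt, intervalIntegral.integral_same]⟩
  have hd := hasDerivAt_slice (y 0) (fun a => y a.succ) (hw.differentiable (by simp) _)
  simp only [hspt] at hd
  have hc : Continuous fun s => u (spt s fun a => y a.succ) :=
    hu.continuous.comp (continuous_spt.comp (Continuous.prodMk_left _))
  have := hd.unique (hc.integral_hasStrictDerivAt 2 (y 0)).hasDerivAt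
  rwa [spt_eta] at this

theorem pder_zero_kleinGordon {w : (Fin 4 → ℝ) → ℝ} (hw : ContDiff ℝ (⊤ : ℕ∞) w) (m : ℝ) :
    pder 0 (kleinGordon m w) = kleinGordon m (pder 0 w) := by
  ext y
  have hd : ∀ {φ : (Fin 4 → ℝ) → ℝ}, ContDiff ℝ (⊤ : ℕ∞) φ → DifferentiableAt ℝ φ y :=
    fun h => h.differentiable (by simp) y
  have h2 : ∀ α, ContDiff ℝ (⊤ : ℕ∞) (pder α (pder α w)) := fun α =>
    contDiff_pder (contDiff_pder hw α) α
  have e : kleinGordon m w = fun y => -1 * (-1 * pder 0 (pder 0 w) y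
      + ∑ a : Fin 3, pder a.succ (pder a.succ w) y) + m ^ 2 * w y := by
    ext y; simp only [kleinGordon, Box]; ring
  have hs : ContDiff ℝ (⊤ : ℕ∞) fun y => ∑ a : Fin 3, pder a.succ (pder a.succ w) y :=
    ContDiff.sum fun a _ => h2 _
  rw [e, pder_add (hd (contDiff_const.mul ((contDiff_const.mul (h2 0)).add hs)))
      (hd (contDiff_const.mul hw)),
    pder_const_mul _ (hd hw), pder_const_mul _ (hd ((contDiff_const.mul (h2 0)).add hs)),
    pder_add (hd (contDiff_const.mul (h2 0))) (hd hs), pder_const_mul _ (hd (h2 0)),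
    pder_sum _ fun a _ => hd (h2 _)]
  simp_rw [fun a : Fin 3 => congrFun (pder_comm (contDiff_pder hw a.succ) 0 a.succ) y,
    fun a : Fin 3 => pder_comm hw 0 a.succ]
  simp only [kleinGordon, Box]
  ring

theorem kleinGordon_eq_pder_zero {w : (Fin 4 → ℝ) → ℝ} (hw : ContDiff ℝ (⊤ : ℕ∞) w) (m : ℝ)
    {t : ℝ} (h : ∀ x, w (spt t x) = 0) (x : Fin 3 → ℝ) :
    kleinGordon m w (spt t x) = pder 0 (pder 0 w) (spt t x) := by
  have h1 : ∀ (a : Fin 3) x, pder a.succ w (spt t x) = 0 := fun a x => by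
    rw [← fderiv_slice_single (hw.differentiable (by simp))]
    simp [h]
  have h2 : ∀ (a : Fin 3), pder a.succ (pder a.succ w) (spt t x) = 0 := fun a => by
    rw [← fderiv_slice_single ((contDiff_pder hw a.succ).differentiable (by simp))]
    simp [h1]
  simp [kleinGordon, Box, h, h2]

/-! ### Schwartz slices -/

theorem integrable_sq_schwartz (W : SchwartzMap (Fin 3 → ℝ) ℝ) : Integrable fun x => W x ^ 2 :=
  (memLp_two_iff_integrable_sq W.continuous.aestronglyMeasurable).1 (W.memLp 2)

theorem continuous_rad : Continuous rad := by
  unfold rad; fun_prop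

theorem integrable_rad_sq_mul_sq_schwartz (W : SchwartzMap (Fin 3 → ℝ) ℝ) :
    Integrable fun x => rad x ^ 2 * W x ^ 2 := by
  obtain ⟨C, hC0, hC⟩ := W.decay 0 0
  refine ((W.integrable_pow_mul volume 2).const_mul (3 * C)).mono'
    ((continuous_rad.pow 2).mul (W.continuous.pow 2)).aestronglyMeasurable
    (Filter.Eventually.of_forall fun x => ?_)
  have h1 : rad x ^ 2 ≤ 3 * ‖x‖ ^ 2 := by
    rw [rad, Real.sq_sqrt (Finset.sum_nonneg fun _ _ => sq_nonneg _)]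
    refine (Finset.sum_le_card_nsmul _ _ (‖x‖ ^ 2) fun i _ => ?_).trans (by simp)
    rw [← sq_abs]
    exact pow_le_pow_left₀ (abs_nonneg _) (norm_le_pi_norm x i) 2
  have h2 : ‖W x‖ ≤ C := by simpa using hC x
  rw [Real.norm_of_nonneg (by positivity), ← sq_abs (W x), ← Real.norm_eq_abs]
  calc rad x ^ 2 * ‖W x‖ ^ 2 ≤ 3 * ‖x‖ ^ 2 * (C * ‖W x‖) := by
        refine mul_le_mul h1 ?_ (by positivity) (by positivity)
        rw [sq]; exact mul_le_mul_of_nonneg_right h2 (norm_nonneg _)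
    _ = _ := by ring

/-! ### The uniform bound -/

theorem exists_integral_sq_le {f : (Fin 4 → ℝ) → ℝ} (hf : Continuous f) {T N : ℝ}
    (hi : ∀ t ∈ Set.Icc 2 T, Integrable fun x => f (spt t x) ^ 2)
    (hN : ∀ t ∈ Set.Icc 2 T, Integrable (fun x => radSq (spt t x) * f (spt t x) ^ 2) ∧
      ∫ x, radSq (spt t x) * f (spt t x) ^ 2 ≤ N) :
    ∃ M, 0 ≤ M ∧ ∀ t ∈ Set.Icc 2 T, ∫ x, f (spt t x) ^ 2 ≤ M := by
  obtain ⟨B, hB⟩ := ((isCompact_Icc (a := 2) (b := T)).prod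
    (isCompact_closedBall (0 : Fin 3 → ℝ) 1)).exists_bound_of_continuousOn
      (hf.comp continuous_spt).continuousOn
  set s := Metric.closedBall (0 : Fin 3 → ℝ) 1 with hs
  have hsm : MeasurableSet s := measurableSet_closedBall
  have hsi : Integrable (s.indicator fun _ => B ^ 2) :=
    (integrable_indicator_iff hsm).2
      (integrableOn_const (isCompact_closedBall _ _).measure_lt_top.ne)
  set I := ∫ x, s.indicator (fun _ => B ^ 2) x with hI
  have hI0 : 0 ≤ I := integral_nonneg fun x => Set.indicator_nonneg (fun _ _ => sq_nonneg B) x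
  refine ⟨max (I + N) 0, le_max_right _ _, fun t ht => le_max_of_le_left ?_⟩
  refine (integral_mono (hi t ht) (hsi.add (hN t ht).1) fun x => ?_).trans
    ((integral_add hsi (hN t ht).1).trans_le (add_le_add_right (hN t ht).2 I))
  change f (spt t x) ^ 2 ≤ s.indicator (fun _ => B ^ 2) x + radSq (spt t x) * f (spt t x) ^ 2
  by_cases hx : x ∈ s
  · have h1 : ‖f (spt t x)‖ ≤ B := hB (t, x) ⟨ht, hx⟩
    have h2 : f (spt t x) ^ 2 ≤ B ^ 2 := sq_le_sq.2 (h1.trans (le_abs_self B))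
    rw [Set.indicator_of_mem hx]
    have := mul_nonneg (radSq_nonneg (spt t x)) (sq_nonneg (f (spt t x)))
    linarith
  · rw [Set.indicator_of_notMem hx, zero_add]
    refine le_mul_of_one_le_left (sq_nonneg _) ?_
    by_contra hlt
    refine hx (mem_closedBall_zero_iff.2 ((pi_norm_le_iff_of_nonneg zero_le_one).2 fun a => ?_))
    have h1 := Finset.single_le_sum (f := fun a => x a ^ 2) (fun i _ => sq_nonneg (x i))
      (Finset.mem_univ a)
    have h2 : radSq (spt t x) = ∑ a, x a ^ 2 := rfl
    rw [Real.norm_eq_abs, ← sq_le_one_iff_abs_le_one]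
    linarith

/-- The `L²` norm of `u` is bounded by its initial value and the weighted norms of `∂ₜu(2)` and of
the source, as `u` is the time derivative of a function with finite energy. -/
theorem sqrt_integral_sq_le {u : (Fin 4 → ℝ) → ℝ} (hu : ContDiff ℝ (⊤ : ℕ∞) u) (m : ℝ)
    {T A N : ℝ} {P P' : ℝ → ℝ} (hT : 2 ≤ T) (hA : 0 ≤ A)
    (hP : ∀ t ∈ Set.Icc 2 T, HasDerivAt P (P' t) t) (hP' : ∀ t ∈ Set.Icc 2 T, 0 ≤ P' t)
    (hN : ∀ t ∈ Set.Icc 2 T, P' t ≤ N)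
    (hu0 : Integrable fun x => u (spt 2 x) ^ 2)
    (hu1 : Integrable fun x => pder 0 u (spt 2 x) ^ 2)
    (hu1r : Integrable (fun x => radSq (spt 2 x) * pder 0 u (spt 2 x) ^ 2) ∧
      ∫ x, radSq (spt 2 x) * pder 0 u (spt 2 x) ^ 2 ≤ A ^ 2)
    (hf : ∀ t ∈ Set.Icc 2 T, Integrable fun x => kleinGordon m u (spt t x) ^ 2)
    (hfr : ∀ t ∈ Set.Icc 2 T,
      Integrable (fun x => radSq (spt t x) * kleinGordon m u (spt t x) ^ 2) ∧
      ∫ x, radSq (spt t x) * kleinGordon m u (spt t x) ^ 2 ≤ P' t ^ 2) :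
    √(∫ x, u (spt T x) ^ 2) ≤ √(∫ x, u (spt 2 x) ^ 2) + 8 * (A + (P T - P 2)) := by
  have h2T : (2 : ℝ) ∈ Set.Icc 2 T := Set.left_mem_Icc.2 hT
  have hTT : T ∈ Set.Icc 2 T := Set.right_mem_Icc.2 hT
  obtain ⟨w, hw, hwu, hw0⟩ := exists_pder_zero_eq hu
  obtain rfl : pder 0 w = u := funext hwu
  have hK := contDiff_kleinGordon hw m
  have hpK := pder_zero_kleinGordon hw m
  have hK2 := kleinGordon_eq_pder_zero hw m hw0
  have hconst : ContDiff ℝ (⊤ : ℕ∞) fun _ : Fin 4 → ℝ => (1 : ℝ) := contDiff_const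
  have hconst0 : ∀ y, pder 0 (fun _ : Fin 4 → ℝ => (1 : ℝ)) y = 0 := fun y => by simp [pder]
  obtain ⟨M, hM0, hM⟩ := exists_integral_sq_le (contDiff_kleinGordon hu m).continuous (N := N ^ 2)
    hf fun t ht => ⟨(hfr t ht).1, (hfr t ht).2.trans
      (pow_le_pow_left₀ (hP' t ht) (hN t ht) 2)⟩
  have hlin : ∀ c : ℝ, ∀ t ∈ Set.Icc 2 T, HasDerivAt (fun t => c * t) c t := fun c t _ => by
    simpa using (hasDerivAt_id t).const_mul c
  set I₁ := ∫ x, pder 0 (pder 0 w) (spt 2 x) ^ 2 with hI₁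
  have hI₁0 : 0 ≤ I₁ := integral_nonneg fun x => sq_nonneg _
  have hF : ∀ t ∈ Set.Icc 2 T, Integrable (fun x => kleinGordon m w (spt t x) ^ 2) ∧
      ∫ x, kleinGordon m w (spt t x) ^ 2 ≤ (√I₁ + √M * (T - 2)) ^ 2 := fun t ht => by
    have := integral_weight_mul_sq_le hK hconst (fun _ => zero_le_one) hconst0
      (Real.sqrt_nonneg I₁) (hlin √M) (fun _ _ => Real.sqrt_nonneg M)
      (fun t ht => by
        simp only [one_mul, hpK, Real.sq_sqrt hM0]
        exact ⟨hf t ht, hM t ht⟩)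
      (by simpa only [one_mul, hK2] using hu1)
      (by simp only [one_mul, hK2, Real.sq_sqrt hI₁0, ← hI₁, le_refl]) ht
    simp only [one_mul, ← mul_sub] at this
    refine ⟨this.1, this.2.trans (pow_le_pow_left₀ ?_ ?_ 2)⟩
    · have := mul_nonneg (Real.sqrt_nonneg M) (sub_nonneg.2 ht.1)
      positivity
    · have := mul_le_mul_of_nonneg_left (sub_le_sub_right ht.2 2) (Real.sqrt_nonneg M)
      linarith
  have hFr := fun t (ht : t ∈ Set.Icc 2 T) =>
    integral_weight_mul_sq_le hK contDiff_radSq radSq_nonneg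
      (fun y => by simp [pder_radSq, Fin.succ_ne_zero]) hA hP hP'
      (fun t ht => by rw [hpK]; exact hfr t ht)
      (by simpa only [hK2] using hu1r.1) (by simpa only [hK2] using hu1r.2) ht
  have hE2 : ∀ x, energyDensity m w (spt 2 x) = pder 0 w (spt 2 x) ^ 2 := fun x => by
    simp [energyDensity, hw0, gradSq_eq_zero hw hw0]
  have hE := fun t (ht : t ∈ Set.Icc 2 T) =>
    integral_energyDensity_le hw m (by simpa only [hE2] using hu0) hF ht
  set K := Real.exp T * ((∫ x, energyDensity m w (spt 2 x)) + (√I₁ + √M * (T - 2)) ^ 2) with hKdef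
  have hE0 : ∀ t, 0 ≤ ∫ x, energyDensity m w (spt t x) := fun t =>
    integral_nonneg fun x => energyDensity_nonneg _ _ _
  have hK0 : 0 ≤ K := (hE0 2).trans (hE 2 h2T).2
  have hui : ∀ t ∈ Set.Icc 2 T, Integrable fun x => pder 0 w (spt t x) ^ 2 := fun t ht =>
    (hE t ht).1.mono' ((hu.continuous.comp (continuous_spt_right t)).pow 2).aestronglyMeasurable
      (Filter.Eventually.of_forall fun x => by
        rw [Real.norm_of_nonneg (sq_nonneg _)]; exact sq_pder_zero_le_energyDensity m w _)
  have hue : ∀ t ∈ Set.Icc 2 T,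
      ∫ x, pder 0 w (spt t x) ^ 2 ≤ ∫ x, energyDensity m w (spt t x) := fun t ht =>
    integral_mono (hui t ht) (hE t ht).1 fun x => sq_pder_zero_le_energyDensity m w _
  have hgi : ∀ t ∈ Set.Icc 2 T, Integrable fun x => gradSq w (spt t x) := fun t ht =>
    (hE t ht).1.mono' ((contDiff_gradSq hw).continuous.comp
      (continuous_spt_right t)).aestronglyMeasurable (Filter.Eventually.of_forall fun x => by
        rw [Real.norm_of_nonneg (gradSq_nonneg _ _)]; exact gradSq_le_energyDensity m w _)
  have hge : ∀ t ∈ Set.Icc 2 T,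
      ∫ x, gradSq w (spt t x) ≤ ∫ x, energyDensity m w (spt t x) := fun t ht =>
    integral_mono (hgi t ht) (hE t ht).1 fun x => gradSq_le_energyDensity m w _
  have hw2 : ∀ t ∈ Set.Icc 2 T, Integrable fun x => w (spt t x) ^ 2 := fun t ht => by
    have := integral_weight_mul_sq_le hw hconst (fun _ => zero_le_one) hconst0
      le_rfl (hlin √K) (fun _ _ => Real.sqrt_nonneg K)
      (fun t ht => by
        simp only [one_mul, Real.sq_sqrt hK0]
        exact ⟨hui t ht, (hue t ht).trans (hE t ht).2⟩)
      (by simp [hw0]) (by simp [hw0]) ht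
    simpa only [one_mul] using this.1
  have hbdd : BddAbove ((fun t => √(∫ x, gradSq w (spt t x))) '' Set.Icc 2 T) := by
    refine ⟨√K, ?_⟩
    rintro _ ⟨t, ht, rfl⟩
    exact Real.sqrt_le_sqrt ((hge t ht).trans (hE t ht).2)
  set S := sSup ((fun t => √(∫ x, gradSq w (spt t x))) '' Set.Icc 2 T) with hSdef
  have hS : ∀ t ∈ Set.Icc 2 T, √(∫ x, gradSq w (spt t x)) ≤ S := fun t ht =>
    le_csSup hbdd ⟨t, ht, rfl⟩
  have hS0 : 0 ≤ S := (Real.sqrt_nonneg _).trans (hS 2 h2T)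
  have hmain := fun t (ht : t ∈ Set.Icc 2 T) =>
    integral_energyDensity_le_of_gradSq_le hw m hA hP hP' hw0 hw2 (fun t ht => (hE t ht).1)
      (fun t ht => (hF t ht).1) hFr (fun t ht => by rw [hpK]; exact hf t ht)
      (fun t ht => by rw [hpK]; exact hfr t ht) hS0 hS ht
  set E₀ := ∫ x, pder 0 w (spt 2 x) ^ 2 with hE₀
  have hE₀0 : 0 ≤ E₀ := integral_nonneg fun x => sq_nonneg _
  have hPm : MonotoneOn P (Set.Icc 2 T) :=
    monotoneOn_of_hasDerivWithinAt_nonneg (convex_Icc _ _)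
      (fun s hs => (hP s hs).continuousAt.continuousWithinAt)
      (fun s hs => (hP s (interior_subset hs)).hasDerivWithinAt)
      (fun s hs => hP' s (interior_subset hs))
  set D := A + (P T - P 2) with hD
  have hD0 : 0 ≤ D := add_nonneg hA (sub_nonneg.2 (hPm h2T hTT hT))
  have hSle : S ≤ √(E₀ + 8 * S * D) := by
    refine csSup_le (Set.Nonempty.image _ ⟨2, h2T⟩) ?_
    rintro _ ⟨t, ht, rfl⟩
    exact Real.sqrt_le_sqrt ((hge t ht).trans (hmain t ht))
  have hSsq : S ^ 2 ≤ E₀ + 8 * S * D := (Real.le_sqrt hS0 (by positivity)).1 hSle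
  have hr := Real.sq_sqrt hE₀0
  have hr0 := Real.sqrt_nonneg E₀
  have hSfin : S ≤ √E₀ + 8 * D := by
    by_contra hlt
    push Not at hlt
    nlinarith [mul_nonneg hr0 hD0]
  refine Real.sqrt_le_iff.2 ⟨by positivity, ((hue T hTT).trans (hmain T hTT)).trans ?_⟩
  nlinarith [mul_le_mul_of_nonneg_right hSfin hD0, mul_nonneg hr0 hD0]

theorem L2norm_le_add_antideriv {q m Cf : ℝ} (hCf : 0 ≤ Cf)
    {u₀ u₁ : SchwartzMap (Fin 3 → ℝ) ℝ} {f u : (Fin 4 → ℝ) → ℝ} (hu : ContDiff ℝ (⊤ : ℕ∞) u)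
    (heq : ∀ y : Fin 4 → ℝ, 2 ≤ y 0 → -Box u y + m ^ 2 * u y = f y)
    (hu₀ : ∀ x, u (spt 2 x) = u₀ x) (hu₁ : ∀ x, pder 0 u (spt 2 x) = u₁ x)
    (hfS : ∀ t : ℝ, 2 ≤ t → ∃ W : SchwartzMap (Fin 3 → ℝ) ℝ, ∀ x, f (spt t x) = W x)
    (hf : ∀ t : ℝ, 2 ≤ t → L2norm (fun x => rad x * f (spt t x)) ≤ Cf * t ^ (-1 + q))
    {P : ℝ → ℝ} (hP : ∀ t : ℝ, 0 < t → HasDerivAt P (t ^ (-1 + q)) t) {t : ℝ} (ht : 2 ≤ t) :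
    L2norm (fun x => u (spt t x)) ≤
      L2norm u₀ + 8 * (L2norm (fun x => rad x * u₁ x) + Cf * (P t - P 2)) := by
  have hK : ∀ s, 2 ≤ s → ∀ x, kleinGordon m u (spt s x) = f (spt s x) := fun s hs x =>
    heq (spt s x) hs
  have hnn : ∀ g : (Fin 3 → ℝ) → ℝ, 0 ≤ L2normSq g := fun g => integral_nonneg fun x => sq_nonneg _
  have hcont : ContinuousOn (fun s : ℝ => Cf * s ^ (-1 + q)) (Set.Icc 2 t) :=
    continuousOn_const.mul (continuousOn_id.rpow_const fun s hs => Or.inl (by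
      simp only [id]; linarith [hs.1]))
  obtain ⟨N, hN⟩ := isCompact_Icc.exists_bound_of_continuousOn hcont
  have key := sqrt_integral_sq_le (P := fun s => Cf * P s) (P' := fun s => Cf * s ^ (-1 + q)) hu m
    ht (Real.sqrt_nonneg (L2normSq fun x => rad x * u₁ x))
    (fun s hs => (hP s (by linarith [hs.1])).const_mul Cf)
    (fun s hs => mul_nonneg hCf (Real.rpow_nonneg (by linarith [hs.1]) _))
    (fun s hs => (le_abs_self _).trans (hN s hs))
    (by simpa only [hu₀] using integrable_sq_schwartz u₀)
    (by simpa only [hu₁] using integrable_sq_schwartz u₁)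
    (by
      simp only [hu₁, radSq_spt, Real.sq_sqrt (hnn _)]
      exact ⟨integrable_rad_sq_mul_sq_schwartz u₁, by simp only [L2normSq, mul_pow, le_refl]⟩)
    (fun s hs => by
      obtain ⟨W, hW⟩ := hfS s hs.1
      simpa only [hK s hs.1, hW] using integrable_sq_schwartz W)
    (fun s hs => by
      obtain ⟨W, hW⟩ := hfS s hs.1
      have h1 := (Real.sqrt_le_iff.1 (hf s hs.1)).2
      simp only [hK s hs.1, radSq_spt]
      refine ⟨by simpa only [hW] using integrable_rad_sq_mul_sq_schwartz W, ?_⟩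
      simpa only [L2normSq, mul_pow] using h1)
  simp only [hu₀, ← mul_sub] at key
  exact key

/-- Uniform `L²` bound for inhomogeneous Klein–Gordon equations
`-□u + m²u = f` on `[2,∞) × ℝ³`, with a constant depending only on `q` (in particular,
independent of the mass `m ∈ [0,1]`). -/
theorem uniform_L2_bound_inhomogeneous_klein_gordon (q : ℝ) :
    ∃ C : ℝ, 0 < C ∧
      ∀ m : ℝ, m ∈ Set.Icc (0:ℝ) 1 →
      ∀ C₀ Cf : ℝ, 0 ≤ C₀ → 0 ≤ Cf →
      ∀ u₀ u₁ : SchwartzMap (Fin 3 → ℝ) ℝ,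
      ∀ f u : (Fin 4 → ℝ) → ℝ,
        ContDiff ℝ (⊤ : ℕ∞) f → ContDiff ℝ (⊤ : ℕ∞) u →
        (∀ y : Fin 4 → ℝ, 2 ≤ y 0 → - Box u y + m^2 * u y = f y) →
        (∀ x, u (spt 2 x) = u₀ x) → (∀ x, pder 0 u (spt 2 x) = u₁ x) →
        (∀ t : ℝ, 2 ≤ t →
          ∃ W : SchwartzMap (Fin 3 → ℝ) ℝ, ∀ x, u (spt t x) = W x) →
        (∀ t : ℝ, 2 ≤ t →
          ∃ W : SchwartzMap (Fin 3 → ℝ) ℝ, ∀ x, pder 0 u (spt t x) = W x) →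
        (∀ t : ℝ, 2 ≤ t →
          ∃ W : SchwartzMap (Fin 3 → ℝ) ℝ, ∀ x, f (spt t x) = W x) →
        L2norm (⇑u₀) + L2norm (fun x => rad x * u₁ x) ≤ C₀ →
        (∀ t : ℝ, 2 ≤ t →
          L2norm (fun x => rad x * f (spt t x)) ≤ Cf * t ^ (-1 + q)) →
        ∀ t : ℝ, 2 ≤ t →
          ((0 < q → L2norm (fun x => u (spt t x)) ≤ C * (C₀ + Cf * t ^ q)) ∧
           (q = 0 → L2norm (fun x => u (spt t x)) ≤ C * (C₀ + Cf * (1 + Real.log t))) ∧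
           (q < 0 → L2norm (fun x => u (spt t x)) ≤ C * (C₀ + Cf))) := by
  refine ⟨8 * (1 + 1 / |q|), by positivity, ?_⟩
  intro m _ C₀ Cf hC₀ hCf u₀ u₁ f u _ hu heq hu₀ hu₁ _ _ hfS hdata hf t ht
  have ht0 : 0 < t := by linarith
  have hc : 0 ≤ 1 / |q| := by positivity
  have core := fun (P : ℝ → ℝ) (hP : ∀ t : ℝ, 0 < t → HasDerivAt P (t ^ (-1 + q)) t) =>
    L2norm_le_add_antideriv hCf hu heq hu₀ hu₁ hfS hf hP ht
  have hn₀ : 0 ≤ L2norm u₀ := Real.sqrt_nonneg _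
  have hfinish : ∀ D E : ℝ, 0 ≤ E → D ≤ (1 + 1 / |q|) * E →
      L2norm (fun x => u (spt t x)) ≤
        L2norm u₀ + 8 * (L2norm (fun x => rad x * u₁ x) + Cf * D) →
      L2norm (fun x => u (spt t x)) ≤ 8 * (1 + 1 / |q|) * (C₀ + Cf * E) := by
    intro D E _ hD h
    have h1 := mul_le_mul_of_nonneg_left hD hCf
    have h2 := mul_nonneg hc hC₀
    linarith
  have hpow : q ≠ 0 → ∀ t : ℝ, 0 < t → HasDerivAt (fun t => t ^ q / q) (t ^ (-1 + q)) t := by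
    intro hq t ht
    refine ((Real.hasDerivAt_rpow_const (Or.inl ht.ne')).div_const q).congr_deriv ?_
    rw [neg_add_eq_sub, mul_div_cancel_left₀ _ hq]
  have htq : 0 ≤ t ^ q := Real.rpow_nonneg ht0.le q
  refine ⟨fun hq => ?_, fun hq => ?_, fun hq => ?_⟩
  · refine hfinish _ _ htq ?_ (core _ (hpow hq.ne'))
    have h2 : 0 ≤ (2 : ℝ) ^ q / q := by positivity
    rw [abs_of_pos hq, add_mul, one_mul, one_div_mul_eq_div]
    linarith
  · have hlog : 0 ≤ Real.log t := Real.log_nonneg (by linarith)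
    have hlog2 : 0 ≤ Real.log 2 := Real.log_nonneg one_le_two
    refine hfinish _ _ (by positivity) ?_ (core Real.log fun s hs => ?_)
    · subst hq
      simp only [abs_zero, div_zero, add_zero, one_mul]
      linarith
    · rw [hq, add_zero, Real.rpow_neg_one]
      exact Real.hasDerivAt_log hs.ne'
  · have h := hfinish _ 1 zero_le_one ?_ (core _ (hpow hq.ne))
    · simpa only [mul_one] using h
    have h2 : (2 : ℝ) ^ q ≤ 1 := Real.rpow_le_one_of_one_le_of_nonpos one_le_two hq.le
    have h3 : (t ^ q / q - 2 ^ q / q) = (2 ^ q - t ^ q) / |q| := by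
      rw [abs_of_neg hq, div_neg, ← neg_div]; ring
    have h4 : (2 ^ q - t ^ q) / |q| ≤ 1 / |q| :=
      div_le_div_of_nonneg_right (by linarith) (abs_nonneg q)
    rw [h3]
    linarith
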